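/- arXiv:1503.06563 — 2 statements merged into one kernel-verified Lean document; each statement's English description precedes it below -/
import Mathlib

section
/- Let Z be a real random variable and K > 0. Assume that for every θ ∈ ℝ with |θ| ≤ 2/√K one has Var(e^{θZ/2}) ≤ K · (θ²/4) · E[e^{θZ}]. Then there exists a numerical constant c > 0 (independent of Z and K) such that for all t ≥ 0, P(|Z − E[Z]| > t) ≤ 6 e^{−c t/√K}. -/
open MeasureTheory ProbabilityTheory Real

lemma aux_half (g : ℝ → ℝ) (a : ℝ) (h0 : g 0 = 0) (hd : HasDerivAt g 0 0)
    (hg : ∀ θ, |θ| ≤ a → g θ ≤ 2 * g (θ / 2)) (θ : ℝ) (hθ : |θ| ≤ a) : g θ ≤ 0 := by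
  have key : ∀ n : ℕ, g θ ≤ 2 ^ n * g (θ * (1 / 2) ^ n) := by
    intro n
    induction n with
    | zero => simp
    | succ n ih =>
      refine ih.trans ?_
      have h1 : |θ * (1 / 2) ^ n| ≤ a := by
        rw [abs_mul, abs_of_nonneg (a := ((1:ℝ) / 2) ^ n) (by positivity)]
        refine (mul_le_of_le_one_right (abs_nonneg _) ?_).trans hθ
        exact pow_le_one₀ (by norm_num) (by norm_num)
      have h2 := hg _ h1
      have h3 : θ * (1 / 2) ^ n / 2 = θ * (1 / 2) ^ (n + 1) := by ring
      rw [h3] at h2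
      calc (2:ℝ) ^ n * g (θ * (1 / 2) ^ n) ≤ 2 ^ n * (2 * g (θ * (1 / 2) ^ (n + 1))) := by
            gcongr
        _ = _ := by ring
  refine le_of_forall_pos_le_add fun ε hε => ?_
  have ho := (hasDerivAt_iff_isLittleO.1 hd).def (c := ε / (|θ| + 1)) (by positivity)
  have ht : Filter.Tendsto (fun n : ℕ => θ * (1 / 2 : ℝ) ^ n) Filter.atTop (nhds 0) := by
    simpa using (tendsto_pow_atTop_nhds_zero_of_lt_one (r := (1 / 2 : ℝ)) (by norm_num)
      (by norm_num)).const_mul θ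
  obtain ⟨n, hn⟩ := (ht.eventually ho).exists
  simp only [h0, sub_zero, smul_zero, Real.norm_eq_abs] at hn
  have h4 := (le_abs_self _).trans hn
  rw [abs_mul, abs_of_nonneg (a := ((1:ℝ) / 2) ^ n) (by positivity)] at h4
  have hp : (2:ℝ) ^ n * (1 / 2) ^ n = 1 := by rw [← mul_pow]; norm_num
  calc g θ ≤ 2 ^ n * g (θ * (1 / 2) ^ n) := key n
    _ ≤ 2 ^ n * (ε / (|θ| + 1) * (|θ| * (1 / 2) ^ n)) := by gcongr
    _ = (2 ^ n * (1 / 2) ^ n) * (ε * (|θ| / (|θ| + 1))) := by ring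
    _ ≤ 1 * (ε * 1) := by
        rw [hp]; gcongr
        rw [div_le_one (by positivity)]; linarith
    _ = 0 + ε := by ring

lemma aux_cgf {Ω : Type} {_ : MeasurableSpace Ω} (P : Measure Ω) [IsProbabilityMeasure P]
    (Z : Ω → ℝ) (hm : Measurable Z) (K : ℝ) (hK : 0 < K)
    (hi : ∀ θ : ℝ, |θ| ≤ 2 / Real.sqrt K → Integrable (fun ω => Real.exp (θ * Z ω)) P)
    (hv : ∀ θ : ℝ, |θ| ≤ 2 / Real.sqrt K →
        variance (fun ω => Real.exp (θ * Z ω / 2)) P ≤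
          K * (θ ^ 2 / 4) * ∫ ω, Real.exp (θ * Z ω) ∂P)
    (θ : ℝ) (hθ : |θ| ≤ 1 / Real.sqrt K) :
    cgf Z P θ ≤ θ * (∫ ω, Z ω ∂P) + 2 / 3 * K * θ ^ 2 := by
  have hs : 0 < Real.sqrt K := Real.sqrt_pos.2 hK
  have h12 : 1 / Real.sqrt K ≤ 2 / Real.sqrt K := by gcongr; norm_num
  have hint : (0:ℝ) ∈ interior (integrableExpSet Z P) := by
    rw [mem_interior_iff_mem_nhds]
    filter_upwards [Metric.closedBall_mem_nhds (0:ℝ) (show 0 < 2 / Real.sqrt K by positivity)]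
      with x hx
    exact hi x (by simpa using hx)
  have hd : HasDerivAt (cgf Z P) (∫ ω, Z ω ∂P) 0 := by
    have := (analyticAt_cgf hint).differentiableAt.hasDerivAt
    rwa [deriv_cgf_zero hint, probReal_univ, div_one] at this
  have := aux_half (fun θ => cgf Z P θ - θ * (∫ ω, Z ω ∂P) - 2 / 3 * K * θ ^ 2)
    (1 / Real.sqrt K) (by simp) ?_ ?_ θ hθ
  · linarith
  · have h := (hd.sub ((hasDerivAt_id (0:ℝ)).mul_const (∫ ω, Z ω ∂P))).sub
      ((hasDerivAt_pow 2 (0:ℝ)).const_mul (2 / 3 * K))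
    have h0 : (∫ ω, Z ω ∂P) - 1 * (∫ ω, Z ω ∂P) - 2 / 3 * K * (((2:ℕ):ℝ) * 0 ^ (2 - 1)) = 0 := by simp
    rw [h0] at h
    exact h
  intro x hx
  have hx2 := hx.trans h12
  have hKx : K * x ^ 2 ≤ 1 := by
    have h1 : |x| * Real.sqrt K ≤ 1 := by rwa [le_div_iff₀ hs] at hx
    have h2 : (|x| * Real.sqrt K) ^ 2 ≤ 1 := pow_le_one₀ (by positivity) h1
    rw [mul_pow, sq_abs, Real.sq_sqrt hK.le] at h2
    linarith
  have hxh : |x / 2| ≤ 2 / Real.sqrt K := by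
    rw [abs_div, abs_two]; linarith [abs_nonneg x]
  have hM : mgf Z P x - mgf Z P (x / 2) ^ 2 ≤ K * (x ^ 2 / 4) * mgf Z P x := by
    have hb := hv x hx2
    have hsq : ∀ ω, Real.exp (x * Z ω / 2) ^ 2 = Real.exp (x * Z ω) := by
      intro ω; rw [← Real.exp_nat_mul]; congr 1; push_cast; ring
    rw [variance_eq_sub] at hb
    · simp only [Pi.pow_apply, hsq] at hb
      have he : ∀ ω, x * Z ω / 2 = x / 2 * Z ω := fun ω => by ring
      simp only [he] at hb
      exact hb
    · rw [memLp_two_iff_integrable_sq (by fun_prop)]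
      simpa only [hsq] using hi x hx2
  have p1 : 0 < mgf Z P x := mgf_pos (hi x hx2)
  have p2 : 0 < mgf Z P (x / 2) := mgf_pos (hi _ hxh)
  have hy : 0 ≤ K * x ^ 2 := by positivity
  have hpos : 0 < 1 - K * x ^ 2 / 4 := by linarith
  have hlog : Real.log (mgf Z P x) + Real.log (1 - K * x ^ 2 / 4)
      ≤ 2 * Real.log (mgf Z P (x / 2)) := by
    rw [← Real.log_mul p1.ne' hpos.ne']
    have : 2 * Real.log (mgf Z P (x / 2)) = Real.log (mgf Z P (x / 2) ^ 2) := by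
      rw [Real.log_pow]; norm_num
    rw [this]
    exact Real.log_le_log (by positivity) (by linarith)
  have hl2 : -(K * x ^ 2 / 3) ≤ Real.log (1 - K * x ^ 2 / 4) := by
    refine le_trans ?_ (Real.one_sub_inv_le_log_of_pos hpos)
    have : (1 - K * x ^ 2 / 4)⁻¹ ≤ 1 + K * x ^ 2 / 3 := by
      rw [inv_le_iff_one_le_mul₀ hpos]
      nlinarith
    linarith
  simp only [cgf]
  nlinarith




/-- **From a Laplace-transform variance bound to exponential concentration**
(Tanguy, Lemma 2.3 / `IPe`). There is a numerical constant `c > 0` such that for every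
integrable random variable `Z` and every `K > 0`: if for all `θ` with `|θ| ≤ 2/√K` one has
`Var(e^{θ Z / 2}) ≤ K (θ²/4) E[e^{θ Z}]` (all these expectations being finite), then
`P(|Z − E[Z]| > t) ≤ 6 e^{−c t / √K}` for all `t ≥ 0`. -/
theorem exp_concentration_of_laplace_variance_bound :
    ∃ c : ℝ, 0 < c ∧
      ∀ (Ω : Type) (_ : MeasurableSpace Ω) (P : Measure Ω), IsProbabilityMeasure P →
      ∀ (Z : Ω → ℝ), Measurable Z → Integrable Z P →
      ∀ (K : ℝ), 0 < K →
      (∀ θ : ℝ, |θ| ≤ 2 / Real.sqrt K →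
        Integrable (fun ω => Real.exp (θ * Z ω)) P) →
      (∀ θ : ℝ, |θ| ≤ 2 / Real.sqrt K →
        variance (fun ω => Real.exp (θ * Z ω / 2)) P ≤
          K * (θ ^ 2 / 4) * ∫ ω, Real.exp (θ * Z ω) ∂P) →
      ∀ t : ℝ, 0 ≤ t →
        (P {ω | t < |Z ω - ∫ ω', Z ω' ∂P|}).toReal ≤
          6 * Real.exp (-c * t / Real.sqrt K) := by
  refine ⟨1, one_pos, ?_⟩
  intro Ω _ P hP Z hm hZ K hK hi hv t ht
  have hs : 0 < Real.sqrt K := Real.sqrt_pos.2 hK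
  set a := 1 / Real.sqrt K with ha
  have ha0 : 0 < a := by positivity
  have h12 : a ≤ 2 / Real.sqrt K := by rw [ha]; gcongr; norm_num
  have hKa : K * a ^ 2 = 1 := by
    rw [ha, div_pow, Real.sq_sqrt hK.le]; field_simp
  have habs : |a| ≤ a := (abs_of_pos ha0).le
  have habs' : |-a| ≤ a := by rw [abs_neg]; exact habs
  have c1 := aux_cgf P Z hm K hK hi hv a habs
  have c2 := aux_cgf P Z hm K hK hi hv (-a) habs'
  set m := ∫ ω, Z ω ∂P with hmdef
  have b1 := measure_ge_le_exp_cgf (μ := P) (X := Z) (m + t) ha0.le (hi a (habs.trans h12))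
  have b2 := measure_le_le_exp_cgf (μ := P) (X := Z) (m - t) (neg_nonpos.2 ha0.le)
    (hi (-a) (habs'.trans h12))
  have d1 : P.real {ω | m + t ≤ Z ω} ≤ Real.exp (2 / 3) * Real.exp (-1 * t / Real.sqrt K) := by
    refine b1.trans ?_
    rw [← Real.exp_add]
    refine Real.exp_le_exp.2 ?_
    have : -1 * t / Real.sqrt K = - (a * t) := by rw [ha]; ring
    rw [this]; nlinarith
  have d2 : P.real {ω | Z ω ≤ m - t} ≤ Real.exp (2 / 3) * Real.exp (-1 * t / Real.sqrt K) := by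
    refine b2.trans ?_
    rw [← Real.exp_add]
    refine Real.exp_le_exp.2 ?_
    have : -1 * t / Real.sqrt K = - (a * t) := by rw [ha]; ring
    rw [this]; nlinarith
  have he : Real.exp (2 / 3) ≤ 3 :=
    (Real.exp_le_exp.2 (by norm_num : (2:ℝ) / 3 ≤ 1)).trans (by linarith [Real.exp_one_lt_d9])
  have hsub : {ω | t < |Z ω - m|} ⊆ {ω | m + t ≤ Z ω} ∪ {ω | Z ω ≤ m - t} := by
    intro ω hω
    simp only [Set.mem_ofPred_eq, lt_abs, Set.mem_union] at hω ⊢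
    rcases hω with h | h
    · left; linarith
    · right; linarith
  calc (P {ω | t < |Z ω - m|}).toReal = P.real {ω | t < |Z ω - m|} := rfl
    _ ≤ P.real ({ω | m + t ≤ Z ω} ∪ {ω | Z ω ≤ m - t}) := measureReal_mono hsub
    _ ≤ P.real {ω | m + t ≤ Z ω} + P.real {ω | Z ω ≤ m - t} := measureReal_union_le _ _
    _ ≤ _ := by nlinarith [Real.exp_pos (-1 * t / Real.sqrt K)]
end

section
/- Let (X_i)_{i≥0} be a centered stationary Gaussian sequence with E[X_i²] = 1 and covariance Cov(X_i, X_j) = φ(|i−j|) for a function φ : ℕ → ℝ. Assume φ is non-increasing and φ(1) < 1/2. Then there exist α = α(φ) ∈ (0,1) and c = c(φ,α) > 0 such that for all n ≥ 2 and all t ≥ 0, P(|M_n − E[M_n]| > t) ≤ 6 exp(−c t / √(max(φ(⌊n^α⌋), 1/log n))), where M_n = max_{1≤i≤n} X_i. -/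
open MeasureTheory ProbabilityTheory Real

namespace SGS
open Filter Topology

/-- exponential growth -/
def EG {V : Type*} [NormedAddCommGroup V] [MeasurableSpace V] (f : V → ℝ) : Prop :=
  Measurable f ∧ ∃ C : ℝ, 0 ≤ C ∧ ∀ x, |f x| ≤ C * exp (C * ‖x‖)

section EGsec
variable {V W : Type*} [NormedAddCommGroup V] [MeasurableSpace V]
  [NormedAddCommGroup W] [MeasurableSpace W]

lemma EG.of_le {f g : V → ℝ} (hg : EG g) (hf : Measurable f) (h : ∀ x, |f x| ≤ |g x|) : EG f := by
  obtain ⟨_, C, hC, hb⟩ := hg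
  exact ⟨hf, C, hC, fun x => (h x).trans (hb x)⟩

lemma EG.of_bound {f : V → ℝ} (hf : Measurable f) (C D : ℝ) (h : ∀ x, |f x| ≤ C * exp (D * ‖x‖)) :
    EG f := by
  refine ⟨hf, max (max C D) 0, le_max_right _ _, fun x => (h x).trans ?_⟩
  have h1 : C ≤ max (max C D) 0 := (le_max_left _ _).trans (le_max_left _ _)
  have h2 : D ≤ max (max C D) 0 := (le_max_right _ _).trans (le_max_left _ _)
  gcongr

lemma EG.const (c : ℝ) : EG (fun _ : V => c) :=
  EG.of_bound measurable_const |c| 0 (by simp)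

lemma EG.mul {f g : V → ℝ} (hf : EG f) (hg : EG g) : EG (fun x => f x * g x) := by
  obtain ⟨hfm, C, hC, hb⟩ := hf
  obtain ⟨hgm, D, hD, hb'⟩ := hg
  refine EG.of_bound (hfm.mul hgm) (C * D) (C + D) fun x => ?_
  rw [abs_mul]
  calc |f x| * |g x| ≤ (C * exp (C * ‖x‖)) * (D * exp (D * ‖x‖)) := by
        gcongr
        exacts [hb x, hb' x]
    _ = _ := by rw [add_mul, Real.exp_add]; ring

lemma EG.add {f g : V → ℝ} (hf : EG f) (hg : EG g) : EG (fun x => f x + g x) := by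
  obtain ⟨hfm, C, hC, hb⟩ := hf
  obtain ⟨hgm, D, hD, hb'⟩ := hg
  refine EG.of_bound (hfm.add hgm) (C + D) (C + D) fun x => ?_
  calc |f x + g x| ≤ |f x| + |g x| := abs_add_le _ _
    _ ≤ C * exp (C * ‖x‖) + D * exp (D * ‖x‖) := add_le_add (hb x) (hb' x)
    _ ≤ C * exp ((C + D) * ‖x‖) + D * exp ((C + D) * ‖x‖) := by
        gcongr <;> linarith
    _ = _ := by ring

lemma EG.const_mul {f : V → ℝ} (hf : EG f) (c : ℝ) : EG (fun x => c * f x) := (EG.const c).mul hf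

lemma EG.sub {f g : V → ℝ} (hf : EG f) (hg : EG g) : EG (fun x => f x - g x) := by
  have := hf.add (hg.const_mul (-1))
  simpa [sub_eq_add_neg] using this

lemma EG.sum {ι : Type*} (s : Finset ι) {f : ι → V → ℝ} (hf : ∀ i, EG (f i)) :
    EG (fun x => ∑ i ∈ s, f i x) := by
  classical
  induction s using Finset.induction_on with
  | empty => simpa using EG.const (V := V) 0
  | insert a s ha ih =>
    simp only [Finset.sum_insert ha]
    exact (hf a).add ih

lemma EG.comp {f : W → ℝ} (hf : EG f) {A : V → W} (hA : Measurable A) (K : ℝ)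
    (hK : ∀ v, ‖A v‖ ≤ K * (1 + ‖v‖)) : EG (fun v => f (A v)) := by
  obtain ⟨hfm, C, hC, hb⟩ := hf
  refine EG.of_bound (hfm.comp hA) (C * exp (C * K)) (C * K) fun x => (hb _).trans ?_
  rw [mul_assoc, ← Real.exp_add]
  have := hK x
  have : C * ‖A x‖ ≤ C * (K * (1 + ‖x‖)) := by gcongr
  gcongr
  linarith

end EGsec

structure GM {n : ℕ} (μ : Measure (Fin n → ℝ)) (Γ : Fin n → Fin n → ℝ) : Prop where
  prob : IsProbabilityMeasure μ
  refl : ∀ a b : ℝ, a ^ 2 + b ^ 2 = 1 →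
    (μ.prod μ).map (fun z : (Fin n → ℝ) × (Fin n → ℝ) => (a • z.1 + b • z.2, b • z.1 - a • z.2))
      = μ.prod μ
  marg : ∀ i, μ.map (fun x => x i) = gaussianReal 0 1
  cov : ∀ i j, ∫ x, x i * x j ∂μ = Γ i j

section GMsec
variable {n : ℕ} {μ : Measure (Fin n → ℝ)} {Γ : Fin n → Fin n → ℝ}

lemma EG.coord (i : Fin n) : EG (fun x : Fin n → ℝ => x i) := by
  refine EG.of_bound (measurable_pi_apply i) 1 1 fun x => ?_
  have h1 : |x i| ≤ ‖x‖ := norm_le_pi_norm x i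
  have := Real.add_one_le_exp ‖x‖
  simp only [one_mul]
  linarith

lemma GM.mom (h : GM μ Γ) (i : Fin n) (t : ℝ) :
    Integrable (fun x => exp (t * x i)) μ ∧ ∫ x, exp (t * x i) ∂μ = exp (t ^ 2 / 2) := by
  have h1 : mgf (fun x : Fin n → ℝ => x i) μ t = _ := mgf_gaussianReal (h.marg i) t
  simp only [ProbabilityTheory.mgf] at h1
  have h2 : ∫ x, exp (t * x i) ∂μ = exp (t ^ 2 / 2) := by rw [h1]; simp
  refine ⟨?_, h2⟩
  by_contra hc
  rw [integral_undef hc] at h2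
  exact (exp_pos _).ne h2

lemma exp_norm_le (hn : 0 < n) (C : ℝ) (hC : 0 ≤ C) (x : Fin n → ℝ) :
    exp (C * ‖x‖) ≤ ∑ i, (exp (C * x i) + exp ((-C) * x i)) := by
  have : Nonempty (Fin n) := ⟨⟨0, hn⟩⟩
  obtain ⟨i, hi⟩ : ∃ i, ‖x‖ ≤ ‖x i‖ := by
    by_contra hc
    push Not at hc
    exact lt_irrefl _ ((pi_norm_lt_iff (lt_of_le_of_lt (norm_nonneg _) (hc ⟨0, hn⟩))).2 hc)
  refine le_trans ?_ (Finset.single_le_sum (f := fun i => exp (C * x i) + exp ((-C) * x i))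
    (fun i _ => by positivity) (Finset.mem_univ i))
  have : ‖x‖ ≤ |x i| := hi
  rcases abs_cases (x i) with h | h
  · have : exp (C * ‖x‖) ≤ exp (C * x i) := by gcongr; linarith
    have := exp_pos (-C * x i)
    linarith
  · have : exp (C * ‖x‖) ≤ exp (-C * x i) := by
      apply exp_le_exp.2; rw [neg_mul, ← mul_neg]; gcongr; linarith
    have := exp_pos (C * x i)
    linarith

lemma GM.int_exp (h : GM μ Γ) (hn : 0 < n) (C : ℝ) (hC : 0 ≤ C) :
    Integrable (fun x => exp (C * ‖x‖)) μ := by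
  have h1 : Integrable (fun x : Fin n → ℝ => ∑ i, (exp (C * x i) + exp ((-C) * x i))) μ :=
    integrable_finsetSum _ fun i _ => (h.mom i C).1.add (h.mom i (-C)).1
  refine h1.mono' (by fun_prop) (Eventually.of_forall fun x => ?_)
  rw [Real.norm_eq_abs, abs_of_pos (exp_pos _)]
  exact exp_norm_le hn C hC x

lemma GM.int (h : GM μ Γ) (hn : 0 < n) {f : (Fin n → ℝ) → ℝ} (hf : EG f) : Integrable f μ := by
  obtain ⟨hfm, C, hC, hb⟩ := hf
  exact ((h.int_exp hn C hC).const_mul C).mono' hfm.aestronglyMeasurable (Eventually.of_forall hb)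

lemma exp_norm_prod (C : ℝ) (hC : 0 ≤ C) (z : (Fin n → ℝ) × (Fin n → ℝ)) :
    exp (C * ‖z‖) ≤ exp (C * ‖z.1‖) * exp (C * ‖z.2‖) := by
  rw [← Real.exp_add, ← mul_add]
  gcongr
  rw [Prod.norm_def]
  exact max_le (by linarith [norm_nonneg z.2]) (by linarith [norm_nonneg z.1])

lemma GM.int2 (h : GM μ Γ) (hn : 0 < n) {f : (Fin n → ℝ) × (Fin n → ℝ) → ℝ} (hf : EG f) :
    Integrable f (μ.prod μ) := by
  have := h.prob
  obtain ⟨hfm, C, hC, hb⟩ := hf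
  have h1 := ((h.int_exp hn C hC).mul_prod (h.int_exp hn C hC)).const_mul C
  refine h1.mono' hfm.aestronglyMeasurable (Eventually.of_forall fun z => (hb z).trans ?_)
  have := exp_norm_prod C hC z
  gcongr

lemma GM.part (h : GM μ Γ) (hn : 0 < n) {f : (Fin n → ℝ) × (Fin n → ℝ) → ℝ} (hf : EG f) :
    EG (fun x => ∫ y, f (x, y) ∂μ) := by
  have := h.prob
  obtain ⟨hfm, C, hC, hb⟩ := hf
  refine EG.of_bound ?_ (C * ∫ y, exp (C * ‖y‖) ∂μ) C fun x => ?_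
  · exact (StronglyMeasurable.integral_prod_right (f := fun x y => f (x, y))
      hfm.stronglyMeasurable).measurable
  · calc |∫ y, f (x, y) ∂μ| ≤ ∫ y, |f (x, y)| ∂μ := abs_integral_le_integral_abs
      _ ≤ ∫ y, (C * exp (C * ‖x‖)) * exp (C * ‖y‖) ∂μ := by
          apply integral_mono_of_nonneg
          · exact Eventually.of_forall fun y => abs_nonneg _
          · exact (h.int_exp hn C hC).const_mul _
          · refine Eventually.of_forall fun y => (hb (x, y)).trans ?_
            have := exp_norm_prod C hC (x, y)
            simp only at this ⊢
            rw [mul_assoc]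
            gcongr
      _ = _ := by rw [integral_const_mul]; ring

lemma EG.lin {f : (Fin n → ℝ) → ℝ} (hf : EG f) (a b : ℝ) :
    EG (fun z : (Fin n → ℝ) × (Fin n → ℝ) => f (a • z.1 + b • z.2)) := by
  refine hf.comp (by fun_prop) (|a| + |b|) fun z => ?_
  calc ‖a • z.1 + b • z.2‖ ≤ ‖a • z.1‖ + ‖b • z.2‖ := norm_add_le _ _
    _ = |a| * ‖z.1‖ + |b| * ‖z.2‖ := by simp [norm_smul]
    _ ≤ |a| * (1 + ‖z‖) + |b| * (1 + ‖z‖) := by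
        have := norm_fst_le z
        have := norm_snd_le z
        gcongr <;> linarith
    _ = _ := by ring

lemma EG.fst {f : (Fin n → ℝ) → ℝ} (hf : EG f) :
    EG (fun z : (Fin n → ℝ) × (Fin n → ℝ) => f z.1) := by
  simpa using hf.lin 1 0

lemma EG.snd {f : (Fin n → ℝ) → ℝ} (hf : EG f) :
    EG (fun z : (Fin n → ℝ) × (Fin n → ℝ) => f z.2) := by
  simpa using hf.lin 0 1

lemma EG.aff {f : (Fin n → ℝ) → ℝ} (hf : EG f) (w : Fin n → ℝ) (b : ℝ) :
    EG (fun y : (Fin n → ℝ) => f (w + b • y)) := by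
  refine hf.comp (by fun_prop) (‖w‖ + |b|) fun z => ?_
  calc ‖w + b • z‖ ≤ ‖w‖ + ‖b • z‖ := norm_add_le _ _
    _ = ‖w‖ + |b| * ‖z‖ := by simp [norm_smul]
    _ ≤ _ := by nlinarith [norm_nonneg w, norm_nonneg z, abs_nonneg b, mul_nonneg (norm_nonneg w) (norm_nonneg z)]

lemma GM.refl_int (h : GM μ Γ) {a b : ℝ} (hab : a ^ 2 + b ^ 2 = 1)
    {f : (Fin n → ℝ) × (Fin n → ℝ) → ℝ} (hf : Measurable f) :
    ∫ z, f (a • z.1 + b • z.2, b • z.1 - a • z.2) ∂(μ.prod μ) = ∫ z, f z ∂(μ.prod μ) := by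
  conv_rhs => rw [← h.refl a b hab]
  rw [integral_map (by fun_prop) hf.aestronglyMeasurable]

/-- two-point functional -/
noncomputable def J (μ : Measure (Fin n → ℝ)) (a b : ℝ) (f g : (Fin n → ℝ) → ℝ) : ℝ :=
  ∫ z, f z.1 * g (a • z.1 + b • z.2) ∂(μ.prod μ)

lemma J_eg {f g : (Fin n → ℝ) → ℝ} (hf : EG f) (hg : EG g) (a b : ℝ) :
    EG (fun z : (Fin n → ℝ) × (Fin n → ℝ) => f z.1 * g (a • z.1 + b • z.2)) :=
  hf.fst.mul (hg.lin a b)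

lemma GM.J_symm (h : GM μ Γ) {a b : ℝ} (hab : a ^ 2 + b ^ 2 = 1) {f g : (Fin n → ℝ) → ℝ}
    (hf : EG f) (hg : EG g) : J μ a b f g = J μ a b g f := by
  unfold J
  rw [← h.refl_int hab (J_eg hf hg a b).1]
  congr 1
  ext z
  have : a • (a • z.1 + b • z.2) + b • (b • z.1 - a • z.2) = z.1 := by
    have : a • (a • z.1 + b • z.2) + b • (b • z.1 - a • z.2) = (a ^ 2 + b ^ 2) • z.1 := by module
    rw [this, hab, one_smul]
  simp only [this]
  ring

lemma GM.J_iter (h : GM μ Γ) (hn : 0 < n) (a b : ℝ) {f g : (Fin n → ℝ) → ℝ}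
    (hf : EG f) (hg : EG g) : J μ a b f g = ∫ x, f x * ∫ y, g (a • x + b • y) ∂μ ∂μ := by
  have := h.prob
  unfold J
  rw [integral_prod _ (h.int2 hn (J_eg hf hg a b))]
  simp only [integral_const_mul]

lemma GM.fst_int (h : GM μ Γ) (f : (Fin n → ℝ) → ℝ) :
    ∫ z, f z.1 ∂(μ.prod μ) = ∫ x, f x ∂μ := by
  have := h.prob
  rw [integral_fun_fst]; simp

lemma GM.lin_int (h : GM μ Γ) (hn : 0 < n) {p q r : ℝ} (hr : r ^ 2 = p ^ 2 + q ^ 2)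
    {f : (Fin n → ℝ) → ℝ} (hf : EG f) (w : Fin n → ℝ) :
    ∫ y, ∫ z, f (w + p • y + q • z) ∂μ ∂μ = ∫ y, f (w + r • y) ∂μ := by
  have := h.prob
  by_cases h0 : r = 0
  · have hp : p = 0 := by nlinarith [sq_nonneg p, sq_nonneg q]
    have hq : q = 0 := by nlinarith [sq_nonneg p, sq_nonneg q]
    simp [h0, hp, hq]
  have hab : (p / r) ^ 2 + (q / r) ^ 2 = 1 := by
    field_simp; linarith
  have hm : Measurable (fun z : (Fin n → ℝ) × (Fin n → ℝ) => f (w + r • z.1)) :=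
    hf.1.comp (by fun_prop)
  have := h.refl_int hab hm
  rw [h.fst_int (fun x => f (w + r • x))] at this
  rw [← this]
  have e : ∀ z : (Fin n → ℝ) × (Fin n → ℝ),
      w + r • ((p / r) • z.1 + (q / r) • z.2) = w + p • z.1 + q • z.2 := by
    intro z
    rw [smul_add, smul_smul, smul_smul, mul_div_cancel₀ _ h0, mul_div_cancel₀ _ h0, add_assoc]
  simp only [e]
  have hE : EG (fun z : (Fin n → ℝ) × (Fin n → ℝ) => f (w + p • z.1 + q • z.2)) := by
    have h2 := hf.aff w 1
    have := h2.lin p q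
    simpa [add_assoc] using this
  rw [integral_prod _ (h.int2 hn hE)]

/-- OU operator -/
noncomputable def PP (μ : Measure (Fin n → ℝ)) (a b : ℝ) (g : (Fin n → ℝ) → ℝ)
    (x : Fin n → ℝ) : ℝ := ∫ y, g (a • x + b • y) ∂μ

lemma GM.PP_eg (h : GM μ Γ) (hn : 0 < n) (a b : ℝ) {g : (Fin n → ℝ) → ℝ} (hg : EG g) :
    EG (PP μ a b g) := h.part hn (hg.lin a b)

lemma GM.J_PP (h : GM μ Γ) (hn : 0 < n) {a b c d : ℝ} (hab : a ^ 2 + b ^ 2 = 1)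
    (hc : c = a ^ 2) (hd : d ^ 2 = 1 - a ^ 4) {g : (Fin n → ℝ) → ℝ} (hg : EG g) :
    ∫ x, PP μ a b g x ^ 2 ∂μ = J μ c d g g := by
  have hP := h.PP_eg hn a b hg
  have h1 : J μ a b (PP μ a b g) g = ∫ x, PP μ a b g x ^ 2 ∂μ := by
    rw [h.J_iter hn a b hP hg]
    simp only [PP, sq]
  rw [← h1, h.J_symm hab hP hg, h.J_iter hn a b hg hP, h.J_iter hn c d hg hg]
  congr 1
  ext x
  congr 1
  have := h.lin_int hn (p := a * b) (q := b) (r := d) (by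
    rw [hd]
    have : b ^ 2 = 1 - a ^ 2 := by linarith
    rw [mul_pow, this]; ring) hg (c • x)
  rw [← this]
  congr 1
  ext y
  simp only [PP]
  congr 1
  ext z
  congr 1
  rw [hc]
  module

end GMsec
end SGS

open MeasureTheory ProbabilityTheory Real

namespace SGS
open Filter Topology

section EG2
variable {V : Type*} [NormedAddCommGroup V] [MeasurableSpace V] [OpensMeasurableSpace V]

lemma EG.norm : EG (fun v : V => ‖v‖) := by
  refine EG.of_bound measurable_norm 1 1 fun x => ?_
  have := Real.add_one_le_exp ‖x‖
  simp only [one_mul, abs_norm]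
  linarith

lemma EG.expnorm (D : ℝ) : EG (fun v : V => exp (D * ‖v‖)) := by
  refine EG.of_bound (by fun_prop) 1 D fun x => ?_
  rw [abs_of_pos (exp_pos _), one_mul]

lemma EG.abs {f : V → ℝ} (hf : EG f) : EG (fun x => |f x|) :=
  hf.of_le hf.1.abs (by simp)
end EG2

variable {n : ℕ} {μ : Measure (Fin n → ℝ)} {Γ : Fin n → Fin n → ℝ}

def HasGrad (u : (Fin n → ℝ) → ℝ) (du : Fin n → (Fin n → ℝ) → ℝ) : Prop :=
  ∀ x, HasFDerivAt u (∑ i, du i x • (ContinuousLinearMap.proj i : (Fin n → ℝ) →L[ℝ] ℝ)) x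

lemma HasGrad.curve {u : (Fin n → ℝ) → ℝ} {du : Fin n → (Fin n → ℝ) → ℝ} (h : HasGrad u du)
    {c : ℝ → Fin n → ℝ} {c' : Fin n → ℝ} {s : ℝ} (hc : HasDerivAt c c' s) :
    HasDerivAt (fun s => u (c s)) (∑ i, du i (c s) * c' i) s := by
  have := (h (c s)).comp_hasDerivAt s hc
  refine this.congr_deriv ?_
  simp [sum_apply]

lemma curve_deriv (x y : Fin n → ℝ) (s : ℝ) :
    HasDerivAt (fun s => cos s • x + sin s • y) ((-sin s) • x + cos s • y) s :=
  ((hasDerivAt_cos s).smul_const x).add ((hasDerivAt_sin s).smul_const y)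

lemma GM.derivJ (h : GM μ Γ) (hn : 0 < n) {k g : (Fin n → ℝ) → ℝ} {dg : Fin n → (Fin n → ℝ) → ℝ}
    (hk : EG k) (hg : EG g) (hdg : ∀ j, EG (dg j)) (hgrad : HasGrad g dg) (s : ℝ) :
    HasDerivAt (fun s => J μ (cos s) (sin s) k g)
      (∫ z, k z.1 * ∑ j, dg j (cos s • z.1 + sin s • z.2) * ((-sin s) * z.1 j + cos s * z.2 j)
        ∂(μ.prod μ)) s := by
  choose C hC hb using fun j => (hdg j).2
  have hkey := hasDerivAt_integral_of_dominated_loc_of_deriv_le (μ := μ.prod μ) (𝕜 := ℝ)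
    (F := fun s (z : (Fin n → ℝ) × (Fin n → ℝ)) => k z.1 * g (cos s • z.1 + sin s • z.2))
    (F' := fun s (z : (Fin n → ℝ) × (Fin n → ℝ)) => k z.1 * ∑ j,
      dg j (cos s • z.1 + sin s • z.2) * ((-sin s) * z.1 j + cos s * z.2 j))
    (x₀ := s) (s := Set.univ)
    (bound := fun z => |k z.1| * ∑ j, (C j * exp ((C j * 2) * ‖z‖)) * (2 * ‖z‖))
    univ_mem ?_ ?_ ?_ ?_ ?_ ?_
  · exact hkey.2
  · exact Eventually.of_forall fun s => (J_eg hk hg _ _).1.aestronglyMeasurable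
  · exact h.int2 hn (J_eg hk hg _ _)
  · refine (EG.mul hk.fst (EG.sum _ fun j => ((hdg j).lin _ _).mul ?_)).1.aestronglyMeasurable
    exact ((EG.coord j).fst.const_mul _).add ((EG.coord j).snd.const_mul _)
  · refine Eventually.of_forall fun z s _ => ?_
    rw [Real.norm_eq_abs, abs_mul]
    gcongr
    refine (Finset.abs_sum_le_sum_abs _ _).trans (Finset.sum_le_sum fun j _ => ?_)
    rw [abs_mul]
    have c1 := abs_cos_le_one s
    have c2 := abs_sin_le_one s
    have n1 := norm_fst_le z
    have n2 := norm_snd_le z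
    have e1 : ‖cos s • z.1 + sin s • z.2‖ ≤ 2 * ‖z‖ := by
      refine (norm_add_le _ _).trans ?_
      rw [norm_smul, norm_smul, Real.norm_eq_abs, Real.norm_eq_abs]
      nlinarith [norm_nonneg z.1, norm_nonneg z.2]
    have e2 : |(-sin s) * z.1 j + cos s * z.2 j| ≤ 2 * ‖z‖ := by
      refine (abs_add_le _ _).trans ?_
      rw [abs_mul, abs_mul, abs_neg]
      have m1 : |z.1 j| ≤ ‖z‖ := (norm_le_pi_norm z.1 j).trans n1
      have m2 : |z.2 j| ≤ ‖z‖ := (norm_le_pi_norm z.2 j).trans n2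
      nlinarith [abs_nonneg (z.1 j), abs_nonneg (z.2 j)]
    have := hC j
    gcongr
    refine (hb j _).trans ?_
    rw [mul_assoc (C j) 2]
    gcongr
  · refine h.int2 hn (EG.mul hk.fst.abs (EG.sum _ fun j => EG.mul ?_ (EG.norm.const_mul 2)))
    exact (EG.expnorm _).const_mul _
  · refine Eventually.of_forall fun z s _ => ?_
    have := (hgrad.curve (curve_deriv z.1 z.2 s)).const_mul (k z.1)
    simpa using this

lemma GM.ibp (h : GM μ Γ) (hn : 0 < n) {u : (Fin n → ℝ) → ℝ} {du : Fin n → (Fin n → ℝ) → ℝ}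
    (hu : EG u) (hdu : ∀ j, EG (du j)) (hgrad : HasGrad u du) (j : Fin n) :
    ∫ x, x j * u x ∂μ = ∑ i, Γ j i * ∫ x, du i x ∂μ := by
  have := h.prob
  have hz : ∫ x, x j ∂μ = 0 := by
    have h1 : ∫ x, x j ∂μ = ∫ y, y ∂(μ.map fun x => x j) := by
      rw [integral_map (measurable_pi_apply j).aemeasurable (by fun_prop)]
    rw [h1, h.marg j]; simp
  have h1 := h.derivJ hn (EG.coord j) hu hdu hgrad (π / 2)
  have h2 : (fun s => J μ (cos s) (sin s) (fun x => x j) u) =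
      fun s => cos s * ∫ x, x j * u x ∂μ := by
    ext s
    rw [h.J_symm (by simp) (EG.coord j) hu, h.J_iter hn _ _ hu (EG.coord j), ← integral_const_mul]
    congr 1
    ext x
    have : ∫ y, (cos s • x + sin s • y) j ∂μ = cos s * x j := by
      simp only [Pi.add_apply, Pi.smul_apply, smul_eq_mul]
      rw [integral_add (integrable_const _) ((h.int hn (EG.coord j)).const_mul _),
        integral_const_mul (sin s), hz]
      simp
    rw [this]; ring
  rw [h2] at h1
  have h3 := ((hasDerivAt_cos (π / 2)).mul_const (∫ x, x j * u x ∂μ)).unique h1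
  simp only [sin_pi_div_two, cos_pi_div_two, zero_smul, one_smul, zero_add, zero_mul,
    add_zero, neg_mul, one_mul, mul_neg, Finset.sum_neg_distrib, integral_neg] at h3
  rw [neg_inj] at h3
  rw [h3]
  have h4 : ∀ z : (Fin n → ℝ) × (Fin n → ℝ), z.1 j * ∑ i, du i z.2 * z.1 i =
      ∑ i, (z.1 j * z.1 i) * du i z.2 := by
    intro z
    rw [Finset.mul_sum]
    exact Finset.sum_congr rfl fun i _ => by ring
  simp only [h4]
  rw [integral_finsetSum]
  · refine Finset.sum_congr rfl fun i _ => ?_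
    rw [integral_prod_mul (fun x : Fin n → ℝ => x j * x i) (du i), h.cov]
  · intro i _
    exact h.int2 hn (((EG.coord j).mul (EG.coord i)).fst.mul (hdu i).snd)

lemma HasGrad.aff {u : (Fin n → ℝ) → ℝ} {du : Fin n → (Fin n → ℝ) → ℝ} (h : HasGrad u du)
    (w : Fin n → ℝ) (b : ℝ) :
    HasGrad (fun y => u (w + b • y)) (fun i y => b * du i (w + b • y)) := by
  intro y
  have h1 : HasFDerivAt (fun y : Fin n → ℝ => w + b • y)
      (b • ContinuousLinearMap.id ℝ (Fin n → ℝ)) y :=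
    ((hasFDerivAt_id y).const_smul b).const_add w
  have := (h (w + b • y)).comp y h1
  refine this.congr_fderiv ?_
  ext v
  simp [sum_apply]
  rw [Finset.mul_sum]
  simp only [mul_assoc]

lemma GM.interp (h : GM μ Γ) (hn : 0 < n) {f g : (Fin n → ℝ) → ℝ}
    {df dg : Fin n → (Fin n → ℝ) → ℝ}
    (hf : EG f) (hdf : ∀ j, EG (df j)) (hfg : HasGrad f df)
    (hg : EG g) (hdg : ∀ j, EG (dg j)) (hgrad : HasGrad g dg) (s : ℝ) :
    HasDerivAt (fun s => J μ (cos s) (sin s) f g)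
      (- sin s * ∑ j, ∑ i, Γ j i * J μ (cos s) (sin s) (df i) (dg j)) s := by
  have := h.prob
  have hcs : cos s ^ 2 + sin s ^ 2 = 1 := by simp
  have h1 := h.derivJ hn hf hg hdg hgrad s
  convert h1 using 1
  have hm : EG (fun z : (Fin n → ℝ) × (Fin n → ℝ) => f z.1 * ∑ j,
      dg j (cos s • z.1 + sin s • z.2) * ((-sin s) * z.1 j + cos s * z.2 j)) := by
    refine (EG.mul hf.fst (EG.sum _ fun j => ((hdg j).lin _ _).mul ?_))
    exact ((EG.coord j).fst.const_mul _).add ((EG.coord j).snd.const_mul _)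
  rw [← h.refl_int hcs hm.1]
  have e1 : ∀ z : (Fin n → ℝ) × (Fin n → ℝ),
      cos s • (cos s • z.1 + sin s • z.2) + sin s • (sin s • z.1 - cos s • z.2) = z.1 := by
    intro z
    have : cos s • (cos s • z.1 + sin s • z.2) + sin s • (sin s • z.1 - cos s • z.2)
      = (cos s ^ 2 + sin s ^ 2) • z.1 := by module
    rw [this, hcs, one_smul]
  have e2 : ∀ (z : (Fin n → ℝ) × (Fin n → ℝ)) (j : Fin n),
      (-sin s) * (cos s • z.1 + sin s • z.2) j + cos s * (sin s • z.1 - cos s • z.2) j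
        = - z.2 j := by
    intro z j
    simp only [Pi.add_apply, Pi.sub_apply, Pi.smul_apply, smul_eq_mul]
    linear_combination (- z.2 j) * hcs
  simp only [e1, e2]
  have e3 : ∀ z : (Fin n → ℝ) × (Fin n → ℝ), f (cos s • z.1 + sin s • z.2) *
      ∑ j, dg j z.1 * - z.2 j =
      - ∑ j, dg j z.1 * (z.2 j * f (cos s • z.1 + sin s • z.2)) := by
    intro z
    rw [Finset.mul_sum, ← Finset.sum_neg_distrib]
    exact Finset.sum_congr rfl fun i _ => by ring
  simp only [e3]
  have hE : ∀ j, EG (fun z : (Fin n → ℝ) × (Fin n → ℝ) =>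
    dg j z.1 * (z.2 j * f (cos s • z.1 + sin s • z.2))) := fun j =>
      (hdg j).fst.mul ((EG.coord j).snd.mul (hf.lin _ _))
  rw [integral_neg, integral_finsetSum _ fun j _ => h.int2 hn (hE j), neg_mul, neg_inj,
    Finset.mul_sum]
  refine Finset.sum_congr rfl fun j _ => ?_
  rw [integral_prod _ (h.int2 hn (hE j))]
  have e4 : ∀ x : Fin n → ℝ, ∫ y, dg j x * (y j * f (cos s • x + sin s • y)) ∂μ =
      ∑ i, (Γ j i * sin s) * (dg j x * ∫ y, df i (cos s • x + sin s • y) ∂μ) := by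
    intro x
    rw [integral_const_mul, h.ibp hn (hf.aff _ _) (fun i => ((hdf i).aff _ _).const_mul _)
      (hfg.aff (cos s • x) (sin s)) j, Finset.mul_sum]
    refine Finset.sum_congr rfl fun i _ => ?_
    rw [integral_const_mul]; ring
  simp only [e4]
  rw [integral_finsetSum]
  · rw [Finset.mul_sum]
    refine Finset.sum_congr rfl fun i _ => ?_
    rw [integral_const_mul, ← h.J_iter hn _ _ (hdg j) (hdf i), h.J_symm hcs (hdf i) (hdg j)]
    ring
  · intro i _
    exact (h.int hn ((hdg j).mul (h.PP_eg hn _ _ (hdf i)))).const_mul _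

lemma GM.J_zero (h : GM μ Γ) (hn : 0 < n) {f g : (Fin n → ℝ) → ℝ} (hf : EG f) (hg : EG g) :
    J μ 0 1 f g = (∫ x, f x ∂μ) * ∫ x, g x ∂μ := by
  have := h.prob
  rw [h.J_iter hn _ _ hf hg]
  simp [integral_mul_const]

lemma GM.J_one (h : GM μ Γ) (hn : 0 < n) {f g : (Fin n → ℝ) → ℝ} (hf : EG f) (hg : EG g) :
    J μ 1 0 f g = ∫ x, f x * g x ∂μ := by
  have := h.prob
  rw [h.J_iter hn _ _ hf hg]
  simp

/-- covariance upper bound by interpolation -/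
lemma GM.cov_le (h : GM μ Γ) (hn : 0 < n) {f g : (Fin n → ℝ) → ℝ}
    {df dg : Fin n → (Fin n → ℝ) → ℝ}
    (hf : EG f) (hdf : ∀ j, EG (df j)) (hfg : HasGrad f df)
    (hg : EG g) (hdg : ∀ j, EG (dg j)) (hgrad : HasGrad g dg)
    (B B' : ℝ → ℝ) (hB : ∀ r, HasDerivAt B (B' r) r)
    (hle : ∀ a b, 0 ≤ a → 0 ≤ b → a ^ 2 + b ^ 2 = 1 →
      ∑ j, ∑ i, Γ j i * J μ a b (df i) (dg j) ≤ B' a) :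
    ∫ x, f x * g x ∂μ - (∫ x, f x ∂μ) * (∫ x, g x ∂μ) ≤ B 1 - B 0 := by
  have hd : ∀ s, HasDerivAt (fun s => J μ (cos s) (sin s) f g - B (cos s))
      (- sin s * ∑ j, ∑ i, Γ j i * J μ (cos s) (sin s) (df i) (dg j) - B' (cos s) * (- sin s)) s :=
    fun s => (h.interp hn hf hdf hfg hg hdg hgrad s).sub ((hB (cos s)).comp s (hasDerivAt_cos s))
  have hmono : MonotoneOn (fun s => J μ (cos s) (sin s) f g - B (cos s)) (Set.Icc 0 (π / 2)) := by
    apply monotoneOn_of_deriv_nonneg (convex_Icc _ _)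
    · exact fun s _ => (hd s).continuousAt.continuousWithinAt
    · exact fun s _ => (hd s).differentiableAt.differentiableWithinAt
    · intro s hs
      rw [interior_Icc] at hs
      rw [(hd s).deriv]
      have hsin : 0 ≤ sin s := sin_nonneg_of_nonneg_of_le_pi hs.1.le (by linarith [hs.2, pi_pos])
      have hcos : 0 ≤ cos s := cos_nonneg_of_neg_pi_div_two_le_of_le
        (by linarith [hs.1, pi_pos]) hs.2.le
      have := hle (cos s) (sin s) hcos hsin (by simp)
      nlinarith
  have := hmono (a := 0) (b := π / 2) ⟨le_refl _, by positivity⟩ ⟨by positivity, le_refl _⟩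
    (by positivity)
  simp only [cos_zero, sin_zero, cos_pi_div_two, sin_pi_div_two] at this
  rw [h.J_zero hn hf hg, h.J_one hn hf hg] at this
  linarith
end SGS

open MeasureTheory ProbabilityTheory Real

namespace SGS
open Filter Topology

variable {n : ℕ} {μ : Measure (Fin n → ℝ)} {Γ : Fin n → Fin n → ℝ}

noncomputable def Zf (β : ℝ) (x : Fin n → ℝ) : ℝ := ∑ i, exp (β * x i)
noncomputable def F (β : ℝ) (x : Fin n → ℝ) : ℝ := log (Zf β x) / β
noncomputable def p (β : ℝ) (i : Fin n) (x : Fin n → ℝ) : ℝ := exp (β * (x i - F β x))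

lemma Zf_pos (hn : 0 < n) (β : ℝ) (x : Fin n → ℝ) : 0 < Zf β x := by
  have : Nonempty (Fin n) := ⟨⟨0, hn⟩⟩
  exact Finset.sum_pos (fun i _ => exp_pos _) Finset.univ_nonempty

lemma exp_F (hn : 0 < n) {β : ℝ} (hβ : 0 < β) (x : Fin n → ℝ) : exp (β * F β x) = Zf β x := by
  unfold F
  rw [mul_div_cancel₀ _ hβ.ne', exp_log (Zf_pos hn β x)]

lemma p_eq (hn : 0 < n) {β : ℝ} (hβ : 0 < β) (i : Fin n) (x : Fin n → ℝ) :
    p β i x = exp (β * x i) / Zf β x := by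
  unfold p
  rw [mul_sub, Real.exp_sub, exp_F hn hβ]

lemma p_pos (β : ℝ) (i : Fin n) (x : Fin n → ℝ) : 0 < p β i x := exp_pos _

lemma p_sum (hn : 0 < n) {β : ℝ} (hβ : 0 < β) (x : Fin n → ℝ) : ∑ i, p β i x = 1 := by
  simp only [p_eq hn hβ, ← Finset.sum_div]
  exact div_self (Zf_pos hn β x).ne'

lemma p_le_one (hn : 0 < n) {β : ℝ} (hβ : 0 < β) (i : Fin n) (x : Fin n → ℝ) : p β i x ≤ 1 := by
  rw [← p_sum hn hβ x]
  exact Finset.single_le_sum (f := fun i => p β i x) (fun i _ => (p_pos β i x).le)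
    (Finset.mem_univ i)

lemma le_F (hn : 0 < n) {β : ℝ} (hβ : 0 < β) (i : Fin n) (x : Fin n → ℝ) : x i ≤ F β x := by
  have h := p_le_one hn hβ i x
  unfold p at h
  rw [exp_le_one_iff] at h
  by_contra hc
  push Not at hc
  have : 0 < β * (x i - F β x) := by apply mul_pos hβ; linarith
  linarith

lemma F_le (hn : 0 < n) {β : ℝ} (hβ : 0 < β) (x : Fin n → ℝ) (m : ℝ) (hm : ∀ i, x i ≤ m) :
    F β x ≤ m + log n / β := by
  unfold F
  rw [div_le_iff₀ hβ, add_mul, div_mul_cancel₀ _ hβ.ne']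
  have h1 : Zf β x ≤ exp (m * β) * n := by
    unfold Zf
    calc ∑ i, exp (β * x i) ≤ ∑ i : Fin n, exp (m * β) := by
          refine Finset.sum_le_sum fun i _ => ?_
          rw [mul_comm m]
          have := hm i
          gcongr
      _ = _ := by simp [mul_comm]
  have hn' : (0 : ℝ) < n := by exact_mod_cast hn
  calc log (Zf β x) ≤ log (exp (m * β) * n) := log_le_log (Zf_pos hn β x) h1
    _ = _ := by rw [log_mul (exp_pos _).ne' hn'.ne', log_exp]

lemma F_meas (β : ℝ) : Measurable (F β : (Fin n → ℝ) → ℝ) := by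
  unfold F Zf
  fun_prop

lemma F_abs (hn : 0 < n) {β : ℝ} (hβ : 0 < β) (x : Fin n → ℝ) :
    |F β x| ≤ ‖x‖ + log n / β := by
  have hn' : (1 : ℝ) ≤ n := by exact_mod_cast hn
  have hl : 0 ≤ log n / β := div_nonneg (log_nonneg hn') hβ.le
  have hb : ∀ i, |x i| ≤ ‖x‖ := fun i => norm_le_pi_norm x i
  rw [abs_le]
  constructor
  · have := le_F hn hβ ⟨0, hn⟩ x
    have := (abs_le.1 (hb ⟨0, hn⟩)).1
    linarith
  · exact F_le hn hβ x _ fun i => (abs_le.1 (hb i)).2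

lemma F_eg (hn : 0 < n) {β : ℝ} (hβ : 0 < β) : EG (F β : (Fin n → ℝ) → ℝ) := by
  have h : EG (fun x : Fin n → ℝ => ‖x‖ + log n / β) := EG.norm.add (EG.const _)
  exact h.of_le (F_meas β) fun x => (F_abs hn hβ x).trans (le_abs_self _)

lemma expF_eg (hn : 0 < n) {β : ℝ} (hβ : 0 < β) (l : ℝ) :
    EG (fun x : Fin n → ℝ => exp (l * F β x)) := by
  have := F_meas (n := n) β
  refine EG.of_bound (by fun_prop) (exp (|l| * (log n / β))) |l| fun x => ?_
  rw [abs_of_pos (exp_pos _), ← Real.exp_add]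
  gcongr
  calc l * F β x ≤ |l| * |F β x| := by rw [← abs_mul]; exact le_abs_self _
    _ ≤ |l| * (‖x‖ + log n / β) := by gcongr; exact F_abs hn hβ x
    _ = _ := by ring

lemma p_eg (hn : 0 < n) {β : ℝ} (hβ : 0 < β) (i : Fin n) : EG (p β i) := by
  have := F_meas (n := n) β
  refine (EG.const 1).of_le (by unfold p; fun_prop) fun x => ?_
  rw [abs_of_pos (p_pos _ _ _), abs_one]
  exact p_le_one hn hβ i x

lemma F_grad (hn : 0 < n) {β : ℝ} (hβ : 0 < β) : HasGrad (n := n) (F β) (p β) := by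
  intro x
  have h1 : HasFDerivAt (fun x : Fin n → ℝ => Zf β x)
      (∑ i, exp (β * x i) • β • (ContinuousLinearMap.proj i : (Fin n → ℝ) →L[ℝ] ℝ)) x := by
    unfold Zf
    refine HasFDerivAt.fun_sum fun i _ => ?_
    exact (((ContinuousLinearMap.proj i : (Fin n → ℝ) →L[ℝ] ℝ).hasFDerivAt).const_mul β).exp
  have h2 := (h1.log (Zf_pos hn β x).ne').mul_const (β⁻¹)
  have h3 : HasFDerivAt (F β) _ x := h2
  refine h3.congr_fderiv ?_
  ext v
  have hz := (Zf_pos hn β x).ne'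
  simp only [sum_apply, smul_apply, ContinuousLinearMap.proj_apply, smul_eq_mul, p_eq hn hβ,
    Finset.mul_sum]
  refine Finset.sum_congr rfl fun i _ => ?_
  field_simp

lemma expF_grad (hn : 0 < n) {β : ℝ} (hβ : 0 < β) (l : ℝ) :
    HasGrad (n := n) (fun x => exp (l * F β x)) (fun i x => l * (exp (l * F β x) * p β i x)) := by
  intro x
  have h3 := ((F_grad hn hβ x).const_mul l).exp
  refine h3.congr_fderiv ?_
  ext v
  simp only [sum_apply, smul_apply, ContinuousLinearMap.proj_apply, smul_eq_mul,
    Finset.mul_sum]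
  refine Finset.sum_congr rfl fun i _ => ?_
  ring

lemma p_grad (hn : 0 < n) {β : ℝ} (hβ : 0 < β) (i : Fin n) :
    HasGrad (n := n) (p β i) (fun j x => β * (p β i x * ((if j = i then 1 else 0) - p β j x))) := by
  intro x
  have h3 : HasFDerivAt (p β i) _ x :=
    ((((ContinuousLinearMap.proj i : (Fin n → ℝ) →L[ℝ] ℝ).hasFDerivAt).sub
      (F_grad hn hβ x)).const_mul β).exp
  refine h3.congr_fderiv ?_
  ext v
  simp only [sum_apply, smul_apply, ContinuousLinearMap.proj_apply, smul_eq_mul,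
    sub_apply, mul_assoc, ← Finset.mul_sum, sub_mul, Finset.sum_sub_distrib]
  simp [p]
  ring

lemma J_sum (h : GM μ Γ) (hn : 0 < n) {u v : Fin n → (Fin n → ℝ) → ℝ} (hu : ∀ i, EG (u i))
    (hv : ∀ i, EG (v i)) (G : Fin n → Fin n → ℝ) (a b : ℝ) :
    ∑ j, ∑ i, G j i * J μ a b (u i) (v j) =
    ∫ z, ∑ j, ∑ i, G j i * (u i z.1 * v j (a • z.1 + b • z.2)) ∂(μ.prod μ) := by
  have hi : ∀ j i, Integrable (fun z : (Fin n → ℝ) × (Fin n → ℝ) =>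
      G j i * (u i z.1 * v j (a • z.1 + b • z.2))) (μ.prod μ) := fun j i =>
    (h.int2 hn (J_eg (hu i) (hv j) a b)).const_mul _
  rw [integral_finsetSum _ fun j _ => integrable_finsetSum _ fun i _ => hi j i]
  refine Finset.sum_congr rfl fun j _ => ?_
  rw [integral_finsetSum _ fun i _ => hi j i]
  refine Finset.sum_congr rfl fun i _ => ?_
  rw [integral_const_mul]; rfl

lemma GM.snd_int (h : GM μ Γ) (hn : 0 < n) {a b : ℝ} (hab : a ^ 2 + b ^ 2 = 1)
    {f : (Fin n → ℝ) → ℝ} (hf : EG f) :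
    ∫ z, f (a • z.1 + b • z.2) ∂(μ.prod μ) = ∫ x, f x ∂μ := by
  have := h.J_symm hab (EG.const 1) hf
  unfold J at this
  simp only [one_mul, mul_one] at this
  rw [this, h.fst_int]

lemma dbl {G : Fin n → Fin n → ℝ} (hG : ∀ i j, G i j ≤ 1) (u v : Fin n → ℝ)
    (hu : ∀ i, 0 ≤ u i) (hv : ∀ i, 0 ≤ v i) :
    ∑ j, ∑ i, G j i * (u i * v j) ≤ (∑ i, u i) * ∑ i, v i := by
  rw [Finset.sum_mul_sum, Finset.sum_comm]
  refine Finset.sum_le_sum fun i _ => Finset.sum_le_sum fun j _ => ?_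
  exact mul_le_of_le_one_left (mul_nonneg (hu i) (hv j)) (hG j i)

lemma herbst (h : GM μ Γ) (hn : 0 < n) (hΓ : ∀ i j, Γ i j ≤ 1) {β : ℝ} (hβ : 0 < β)
    {ε : ℝ} (hε : ε ^ 2 = 1) {l : ℝ} (hl : 0 ≤ l) :
    ∫ x, exp (l * (ε * F β x)) ∂μ ≤ exp (l * (ε * ∫ x, F β x ∂μ) + l ^ 2 / 2) := by
  have := h.prob
  set m := ∫ x, F β x ∂μ with hm
  have hF := F_eg hn hβ
  have hint : ∀ t, Integrable (fun x : Fin n → ℝ => exp (t * (ε * F β x))) μ := fun t => by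
    have := h.int hn (expF_eg hn hβ (t * ε))
    simpa only [mul_assoc] using this
  have hset : integrableExpSet (fun x : Fin n → ℝ => ε * F β x) μ = Set.univ := by
    ext t; simp [integrableExpSet, hint t]
  have hd : ∀ t, HasDerivAt (mgf (fun x : Fin n → ℝ => ε * F β x) μ)
      (∫ x, (ε * F β x) * exp (t * (ε * F β x)) ∂μ) t := fun t =>
    hasDerivAt_mgf (by rw [hset]; simp)
  have hkey : ∀ t, 0 ≤ t → ∫ x, (ε * F β x) * exp (t * (ε * F β x)) ∂μ
      ≤ (ε * m + t) * mgf (fun x : Fin n → ℝ => ε * F β x) μ t := by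
    intro t ht
    set A := mgf (fun x : Fin n → ℝ => ε * F β x) μ t with hA
    have hA' : A = ∫ x, exp ((t * ε) * F β x) ∂μ := by
      simp only [hA, mgf, mul_assoc]
    have hc := h.cov_le hn (f := fun x => ε * F β x) (df := fun i x => ε * p β i x)
      (g := fun x => exp ((t * ε) * F β x)) (hF.const_mul ε) (fun i => (p_eg hn hβ i).const_mul ε)
      (fun x => by
        refine ((F_grad hn hβ x).const_mul ε).congr_fderiv ?_
        rw [Finset.smul_sum]; simp only [smul_smul])
      (expF_eg hn hβ _) (fun i => ((expF_eg hn hβ _).mul (p_eg hn hβ i)).const_mul _)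
      (expF_grad hn hβ (t * ε)) (fun r => t * A * r) (fun r => t * A)
      (fun r => by simpa using (hasDerivAt_id r).const_mul (t * A))
      (fun a b ha hb hab => by
        rw [J_sum h hn (fun i => (p_eg hn hβ i).const_mul ε)
          (fun i => ((expF_eg hn hβ _).mul (p_eg hn hβ i)).const_mul _)]
        rw [hA', ← h.snd_int hn hab (expF_eg hn hβ (t * ε)), ← integral_const_mul]
        refine integral_mono (h.int2 hn (EG.sum _ fun j => EG.sum _ fun i => EG.const_mul
          (((p_eg hn hβ i).const_mul ε).fst.mul
          ((((expF_eg hn hβ _).mul (p_eg hn hβ j)).const_mul _).lin a b)) _))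
          (h.int2 hn (((expF_eg hn hβ _).lin a b).const_mul t)) fun z => ?_
        have h1 := dbl hΓ (fun i => p β i z.1) (fun i => p β i (a • z.1 + b • z.2))
          (fun i => (p_pos _ _ _).le) (fun i => (p_pos _ _ _).le)
        rw [p_sum hn hβ, p_sum hn hβ, mul_one] at h1
        have h2 : 0 ≤ t * exp (t * ε * F β (a • z.1 + b • z.2)) := by positivity
        calc _ = (t * exp (t * ε * F β (a • z.1 + b • z.2))) *
              ∑ j, ∑ i, Γ j i * (p β i z.1 * p β j (a • z.1 + b • z.2)) := by
              simp only [Finset.mul_sum]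
              refine Finset.sum_congr rfl fun j _ => Finset.sum_congr rfl fun i _ => ?_
              linear_combination (Γ j i * p β i z.1 * t * p β j (a • z.1 + b • z.2) *
                exp (t * ε * F β (a • z.1 + b • z.2))) * hε
          _ ≤ _ := mul_le_of_le_one_right h2 h1)
    simp only [integral_const_mul, ← hA', ← hm] at hc
    have e : ∀ x : Fin n → ℝ, exp (t * (ε * F β x)) = exp (t * ε * F β x) := fun x => by
      rw [mul_assoc]
    simp only [e]
    linarith
  have hq : ∀ t, HasDerivAt (fun t => mgf (fun x : Fin n → ℝ => ε * F β x) μ t *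
      exp (-(t * (ε * m) + t ^ 2 / 2)))
      ((∫ x, (ε * F β x) * exp (t * (ε * F β x)) ∂μ) * exp (-(t * (ε * m) + t ^ 2 / 2)) +
       mgf (fun x : Fin n → ℝ => ε * F β x) μ t * (exp (-(t * (ε * m) + t ^ 2 / 2)) *
        (-(ε * m + t)))) t := by
    intro t
    refine (hd t).mul (HasDerivAt.exp ?_)
    have := (((hasDerivAt_id t).mul_const (ε * m)).add (((hasDerivAt_id t).pow 2).div_const 2)).neg
    refine (this.congr_deriv ?_)
    simp
  have hanti : AntitoneOn (fun t => mgf (fun x : Fin n → ℝ => ε * F β x) μ t *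
      exp (-(t * (ε * m) + t ^ 2 / 2))) (Set.Ici 0) := by
    apply antitoneOn_of_deriv_nonpos (convex_Ici _)
    · exact fun s _ => (hq s).continuousAt.continuousWithinAt
    · exact fun s _ => (hq s).differentiableAt.differentiableWithinAt
    · intro s hs
      rw [interior_Ici] at hs
      rw [(hq s).deriv]
      have := hkey s (le_of_lt hs)
      have := exp_pos (-(s * (ε * m) + s ^ 2 / 2))
      nlinarith
  have := hanti (a := 0) (b := l) (by simp) hl hl
  simp only [mgf_zero, zero_mul] at this
  rw [Real.exp_neg, ← div_eq_mul_inv, div_le_iff₀ (exp_pos _)] at this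
  simpa [mgf] using this

end SGS

open MeasureTheory ProbabilityTheory Real

namespace SGS
open Filter Topology

variable {n : ℕ} {μ : Measure (Fin n → ℝ)} {Γ : Fin n → Fin n → ℝ}

lemma herbst' (h : GM μ Γ) (hn : 0 < n) (hΓ : ∀ i j, Γ i j ≤ 1) {β : ℝ} (hβ : 0 < β) (l : ℝ) :
    ∫ x, exp (l * F β x) ∂μ ≤ exp (l * ∫ x, F β x ∂μ + l ^ 2 / 2) := by
  rcases le_total 0 l with hl | hl
  · simpa using herbst h hn hΓ hβ (ε := 1) (by norm_num) hl
  · simpa using herbst h hn hΓ hβ (ε := -1) (by norm_num) (l := -l) (by linarith)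

lemma jensen (h : GM μ Γ) (hn : 0 < n) {β : ℝ} (hβ : 0 < β) (l : ℝ) :
    exp (l * ∫ x, F β x ∂μ) ≤ ∫ x, exp (l * F β x) ∂μ := by
  have := h.prob
  set m := ∫ x, F β x ∂μ with hm
  have h1 : ∫ x, exp (l * m) * (1 + l * (F β x - m)) ∂μ ≤ ∫ x, exp (l * F β x) ∂μ := by
    refine integral_mono (((integrable_const 1).add
      (((h.int hn (F_eg hn hβ)).sub (integrable_const m)).const_mul l)).const_mul _)
      (h.int hn (expF_eg hn hβ l)) fun x => ?_
    have := Real.add_one_le_exp (l * (F β x - m))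
    have e : exp (l * F β x) = exp (l * m) * exp (l * (F β x - m)) := by
      rw [← Real.exp_add]; ring_nf
    simp only [e]
    gcongr
    linarith
  have h2 : ∫ x, (1 + l * (F β x - m)) ∂μ = 1 := by
    have hI : Integrable (fun x => l * (F β x - m)) μ :=
      ((h.int hn (F_eg hn hβ)).sub (integrable_const m)).const_mul l
    rw [integral_add (integrable_const 1) hI, integral_const_mul,
      integral_sub (h.int hn (F_eg hn hβ)) (integrable_const m)]
    simp [← hm]
  rw [integral_const_mul, h2, mul_one] at h1
  exact h1

lemma tail_coord (h : GM μ Γ) (i : Fin n) {u : ℝ} (hu : 0 ≤ u) :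
    μ.real {x | u ≤ x i} ≤ exp (-(u ^ 2 / 2)) := by
  have := h.prob
  have := measure_ge_le_exp_mul_mgf (μ := μ) (X := fun x : Fin n → ℝ => x i) u hu (h.mom i u).1
  refine this.trans ?_
  simp only [ProbabilityTheory.mgf]
  rw [(h.mom i u).2, ← Real.exp_add]
  apply exp_le_exp.2
  nlinarith

lemma tail_coord' (h : GM μ Γ) (i : Fin n) {u : ℝ} (hu : 0 ≤ u) :
    μ.real {x | x i ≤ -u} ≤ exp (-(u ^ 2 / 2)) := by
  have := h.prob
  have := measure_le_le_exp_mul_mgf (μ := μ) (X := fun x : Fin n → ℝ => x i) (t := -u) (-u)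
    (by linarith) (h.mom i (-u)).1
  refine this.trans ?_
  simp only [ProbabilityTheory.mgf]
  rw [(h.mom i (-u)).2, ← Real.exp_add]
  apply exp_le_exp.2
  nlinarith

lemma tail_F (h : GM μ Γ) (hn : 0 < n) (hΓ : ∀ i j, Γ i j ≤ 1) {β : ℝ} (hβ : 0 < β)
    {s : ℝ} (hs : 0 ≤ s) :
    μ.real {x | F β x ≤ (∫ x, F β x ∂μ) - s} ≤ exp (-(s ^ 2 / 2)) := by
  have := h.prob
  have h1 := measure_le_le_exp_mul_mgf (μ := μ) (X := F β) (t := -s) ((∫ x, F β x ∂μ) - s)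
    (by linarith) (h.int hn (expF_eg hn hβ (-s)))
  refine h1.trans ?_
  have h2 := herbst' h hn hΓ hβ (-s)
  simp only [ProbabilityTheory.mgf]
  refine (mul_le_mul_of_nonneg_left h2 (exp_pos _).le).trans ?_
  rw [← Real.exp_add]
  apply exp_le_exp.2
  nlinarith

lemma p_sq_le (hn : 0 < n) {b : ℝ} (hb : 0 < b) (i : Fin n) (x : Fin n → ℝ) :
    (n : ℝ) ^ 3 * p b i x ^ 2 ≤ ∑ j, (exp ((4 * b) * x i) + exp ((-(4 * b)) * x j)) / 2 := by
  have hZ := Zf_pos hn b x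
  have hn' : (0 : ℝ) < n := by exact_mod_cast hn
  set W := ∑ j, exp (-(b * x j)) with hW
  have hWp : 0 ≤ W := Finset.sum_nonneg fun i _ => (exp_pos _).le
  have c1 : (n : ℝ) ^ 2 ≤ Zf b x * W := by
    have := Finset.sum_mul_sq_le_sq_mul_sq Finset.univ (fun j => exp (b * x j / 2))
      (fun j => exp (-(b * x j) / 2))
    have e0 : ∀ j, exp (b * x j / 2) * exp (-(b * x j) / 2) = 1 := fun j => by
      rw [← Real.exp_add]; ring_nf; simp
    have e1 : ∀ j, exp (b * x j / 2) ^ 2 = exp (b * x j) := fun j => by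
      rw [← Real.exp_nat_mul]; congr 1; push_cast; ring
    have e2 : ∀ j, exp (-(b * x j) / 2) ^ 2 = exp (-(b * x j)) := fun j => by
      rw [← Real.exp_nat_mul]; congr 1; push_cast; ring
    simp only [e0, e1, e2] at this
    simpa [Zf, hW] using this
  have c2 : W ^ 2 ≤ n * ∑ j, exp (-(2 * b * x j)) := by
    have := sq_sum_le_card_mul_sum_sq (s := Finset.univ) (f := fun j => exp (-(b * x j)))
    have e2 : ∀ j, exp (-(b * x j)) ^ 2 = exp (-(2 * b * x j)) := fun j => by
      rw [← Real.exp_nat_mul]; congr 1; push_cast; ring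
    simp only [e2] at this
    simpa using this
  set Q := ∑ j, exp (-(2 * b * x j)) with hQ
  have c3 : (n : ℝ) ^ 3 ≤ Zf b x ^ 2 * Q := by
    have h4 : ((n : ℝ) ^ 2) ^ 2 ≤ (Zf b x * W) ^ 2 := by gcongr
    have h5 : (Zf b x * W) ^ 2 ≤ Zf b x ^ 2 * (n * Q) := by
      rw [mul_pow]; gcongr
    have h6 : (n : ℝ) * n ^ 3 ≤ n * (Zf b x ^ 2 * Q) := by nlinarith
    exact le_of_mul_le_mul_left h6 hn'
  have c4 : (n : ℝ) ^ 3 * p b i x ^ 2 ≤ exp (2 * b * x i) * Q := by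
    rw [p_eq hn hb, div_pow, mul_div_assoc', div_le_iff₀ (by positivity)]
    have : exp (b * x i) ^ 2 = exp (2 * b * x i) := by
      rw [← Real.exp_nat_mul]; congr 1; push_cast; ring
    rw [this]
    have := exp_pos (2 * b * x i)
    nlinarith
  refine c4.trans ?_
  rw [hQ, Finset.mul_sum]
  refine Finset.sum_le_sum fun j _ => ?_
  have e1 : exp ((4 * b) * x i) = exp (2 * b * x i) ^ 2 := by
    rw [← Real.exp_nat_mul]; congr 1; push_cast; ring
  have e2 : exp ((-(4 * b)) * x j) = exp (-(2 * b * x j)) ^ 2 := by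
    rw [← Real.exp_nat_mul]; congr 1; push_cast; ring
  rw [e1, e2]
  nlinarith [sq_nonneg (exp (2 * b * x i) - exp (-(2 * b * x j)))]

lemma p_sq_int (h : GM μ Γ) (hn : 0 < n) {b : ℝ} (hb : 0 < b) (i : Fin n) :
    (n : ℝ) ^ 2 * ∫ x, p b i x ^ 2 ∂μ ≤ exp (8 * b ^ 2) := by
  have hn' : (0 : ℝ) < n := by exact_mod_cast hn
  have hi : ∀ j, Integrable (fun x : Fin n → ℝ =>
      (exp ((4 * b) * x i) + exp ((-(4 * b)) * x j)) / 2) μ := fun j =>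
    ((h.mom i _).1.add (h.mom j _).1).div_const 2
  have h1 : ∫ x, (n : ℝ) ^ 3 * p b i x ^ 2 ∂μ ≤
      ∫ x, ∑ j, (exp ((4 * b) * x i) + exp ((-(4 * b)) * x j)) / 2 ∂μ := by
    refine integral_mono ?_ (integrable_finsetSum _ fun j _ => hi j) fun x => p_sq_le hn hb i x
    have := h.int hn (((p_eg hn hb i).mul (p_eg hn hb i)).const_mul ((n : ℝ) ^ 3))
    simpa only [sq] using this
  rw [integral_const_mul, integral_finsetSum _ fun j _ => hi j] at h1
  have h2 : ∀ j, ∫ x, (exp ((4 * b) * x i) + exp ((-(4 * b)) * x j)) / 2 ∂μ = exp (8 * b ^ 2) := by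
    intro j
    rw [integral_div, integral_add (h.mom i _).1 (h.mom j _).1, (h.mom i _).2, (h.mom j _).2]
    have e1 : (4 * b) ^ 2 / 2 = 8 * b ^ 2 := by ring
    have e2 : (-(4 * b)) ^ 2 / 2 = 8 * b ^ 2 := by ring
    rw [e1, e2]; ring
  simp only [h2] at h1
  simp only [Finset.sum_const, Finset.card_univ, Fintype.card_fin, nsmul_eq_mul] at h1
  have : (n : ℝ) * (n ^ 2 * ∫ x, p b i x ^ 2 ∂μ) ≤ n * exp (8 * b ^ 2) := by
    calc _ = (n : ℝ) ^ 3 * ∫ x, p b i x ^ 2 ∂μ := by ring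
      _ ≤ _ := h1
  exact le_of_mul_le_mul_left this hn'

lemma mean_lower (h : GM μ Γ) (hn : 4 ≤ n) (hd : ∀ i, Γ i i = 1)
    (ho : ∀ i j, i ≠ j → Γ i j ≤ 1 / 2) {β : ℝ} (hβ : 0 < β) :
    sqrt (log n) / 16 ≤ ∫ x, F β x ∂μ := by
  have := h.prob
  have hn0 : 0 < n := by omega
  have hn4 : (4 : ℝ) ≤ n := by exact_mod_cast hn
  have hlog : 0 < log n := log_pos (by linarith)
  set L := sqrt (log n) with hL
  have hLp : 0 < L := sqrt_pos.2 hlog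
  have hL2 : L ^ 2 = log n := sq_sqrt hlog.le
  set b := L / 4 with hb
  have hbp : 0 < b := by positivity
  have hpe := fun i => p_eg hn0 hbp (n := n) i
  -- sum of squares
  have hsq : ∑ i, ∫ x, p b i x ^ 2 ∂μ ≤ 1 / 2 := by
    have h1 : ∀ i : Fin n, ∫ x, p b i x ^ 2 ∂μ ≤ exp (8 * b ^ 2) / (n : ℝ) ^ 2 := fun i => by
      rw [le_div_iff₀ (by positivity), mul_comm]; exact p_sq_int h hn0 hbp i
    have h2 : exp (8 * b ^ 2) ^ 2 = n := by
      rw [← Real.exp_nat_mul]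
      have : ((2 : ℕ) : ℝ) * (8 * b ^ 2) = log n := by rw [hb, ← hL2]; push_cast; ring
      rw [this, exp_log (by linarith)]
    have h3 : exp (8 * b ^ 2) ≤ n / 2 := by
      apply le_of_sq_le_sq _ (by positivity)
      rw [h2]; nlinarith
    calc _ ≤ ∑ i : Fin n, exp (8 * b ^ 2) / (n : ℝ) ^ 2 := Finset.sum_le_sum fun i _ => h1 i
      _ = exp (8 * b ^ 2) / n := by simp; field_simp
      _ ≤ 1 / 2 := by rw [div_le_iff₀ (by linarith)]; linarith
  have hI1 : ∀ i : Fin n, Integrable (fun x => x i * p b i x) μ := fun i =>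
    h.int hn0 ((EG.coord i).mul (hpe i))
  have step1 : ∑ i, ∫ x, x i * p b i x ∂μ ≤ ∫ x, F β x ∂μ := by
    rw [← integral_finsetSum _ fun i _ => hI1 i]
    refine integral_mono (integrable_finsetSum _ fun i _ => hI1 i) (h.int hn0 (F_eg hn0 hβ))
      fun x => ?_
    calc ∑ i, x i * p b i x ≤ ∑ i, F β x * p b i x := by
          refine Finset.sum_le_sum fun i _ => ?_
          exact mul_le_mul_of_nonneg_right (le_F hn0 hβ i x) (p_pos _ _ _).le
      _ = F β x := by rw [← Finset.mul_sum, p_sum hn0 hbp, mul_one]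
  have hdp : ∀ i j : Fin n, EG (fun x => b * (p b i x * ((if j = i then 1 else 0) - p b j x))) :=
    fun i j => ((hpe i).mul ((EG.const _).sub (hpe j))).const_mul _
  have step2 : ∑ i, ∫ x, x i * p b i x ∂μ =
      ∫ x, ∑ i, ∑ j, Γ i j * (b * (p b i x * ((if j = i then 1 else 0) - p b j x))) ∂μ := by
    have hi : ∀ i j : Fin n, Integrable (fun x => Γ i j *
      (b * (p b i x * ((if j = i then 1 else 0) - p b j x)))) μ := fun i j =>
        (h.int hn0 (hdp i j)).const_mul _
    rw [integral_finsetSum _ fun i _ => integrable_finsetSum _ fun j _ => hi i j]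
    refine Finset.sum_congr rfl fun i _ => ?_
    rw [integral_finsetSum _ fun j _ => hi i j, h.ibp hn0 (hpe i) (hdp i) (p_grad hn0 hbp i) i]
    refine Finset.sum_congr rfl fun j _ => ?_
    exact (integral_const_mul _ _).symm
  have hI2 : ∀ i : Fin n, Integrable (fun x => p b i x ^ 2) μ := fun i => by
    have := h.int hn0 ((hpe i).mul (hpe i))
    simpa only [sq] using this
  have step3 : ∫ x, b / 2 * (1 - ∑ i, p b i x ^ 2) ∂μ ≤
      ∫ x, ∑ i, ∑ j, Γ i j * (b * (p b i x * ((if j = i then 1 else 0) - p b j x))) ∂μ := by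
    refine integral_mono (((integrable_const 1).sub
      (integrable_finsetSum _ fun i _ => hI2 i)).const_mul _)
      (h.int hn0 (EG.sum _ fun i => EG.sum _ fun j => (hdp i j).const_mul _)) fun x => ?_
    have e1 : ∑ i, ∑ j, Γ i j * (b * (p b i x * ((if j = i then 1 else 0) - p b j x))) =
        b * (1 - ∑ i, ∑ j, Γ i j * (p b i x * p b j x)) := by
      have : ∀ i j : Fin n, Γ i j * (b * (p b i x * ((if j = i then 1 else 0) - p b j x))) =
        b * ((if j = i then Γ i j * p b i x else 0) - Γ i j * (p b i x * p b j x)) := by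
        intro i j
        split_ifs <;> ring
      simp only [this, ← Finset.mul_sum, Finset.sum_sub_distrib]
      simp [hd, p_sum hn0 hbp]
    have e2 : ∑ i, ∑ j, Γ i j * (p b i x * p b j x) ≤ 1 / 2 + (∑ i, p b i x ^ 2) / 2 := by
      have : ∀ i j : Fin n, Γ i j * (p b i x * p b j x) ≤
          1 / 2 * (p b i x * p b j x) + (if j = i then p b i x ^ 2 / 2 else 0) := by
        intro i j
        have hp := mul_pos (p_pos b i x) (p_pos b j x)
        split_ifs with hij
        · subst hij
          rw [hd]; apply le_of_eq; ring
        · have := ho i j (Ne.symm hij)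
          nlinarith
      calc _ ≤ ∑ i, ∑ j, (1 / 2 * (p b i x * p b j x) + (if j = i then p b i x ^ 2 / 2 else 0)) :=
            Finset.sum_le_sum fun i _ => Finset.sum_le_sum fun j _ => this i j
        _ = _ := by
            simp only [Finset.sum_add_distrib, ← Finset.mul_sum, ← Finset.sum_mul,
              p_sum hn0 hbp]
            simp [p_sum hn0 hbp, Finset.sum_div]
    simp only
    rw [e1]
    nlinarith
  have step4 : ∫ x, b / 2 * (1 - ∑ i, p b i x ^ 2) ∂μ = b / 2 * (1 - ∑ i, ∫ x, p b i x ^ 2 ∂μ) := by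
    rw [integral_const_mul, integral_sub (integrable_const 1)
      (integrable_finsetSum _ fun i _ => hI2 i), integral_finsetSum _ fun i _ => hI2 i]
    simp
  have : L / 16 ≤ b / 2 * (1 - ∑ i, ∫ x, p b i x ^ 2 ∂μ) := by
    have : L / 16 = b / 2 * (1 / 2) := by rw [hb]; ring
    rw [this]
    gcongr
    linarith
  linarith

end SGS

open MeasureTheory ProbabilityTheory Real

namespace SGS
open Filter Topology

variable {n : ℕ} {μ : Measure (Fin n → ℝ)} {Γ : Fin n → Fin n → ℝ}

noncomputable def q (β : ℝ) (C : Finset (Fin n)) (x : Fin n → ℝ) : ℝ := ∑ i ∈ C, p β i x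

lemma q_nonneg (β : ℝ) (C : Finset (Fin n)) (x : Fin n → ℝ) : 0 ≤ q β C x :=
  Finset.sum_nonneg fun i _ => (p_pos β i x).le

lemma q_le_one (hn : 0 < n) {β : ℝ} (hβ : 0 < β) (C : Finset (Fin n)) (x : Fin n → ℝ) :
    q β C x ≤ 1 := by
  rw [← p_sum hn hβ x]
  exact Finset.sum_le_sum_of_subset_of_nonneg (Finset.subset_univ _) fun i _ _ => (p_pos β i x).le

lemma q_eg (hn : 0 < n) {β : ℝ} (hβ : 0 < β) (C : Finset (Fin n)) : EG (q β C) :=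
  EG.sum C fun i => p_eg hn hβ i

lemma real_finset_union (h : GM μ Γ) (C : Finset (Fin n)) (s : Fin n → Set (Fin n → ℝ)) {r : ℝ}
    (hs : ∀ i ∈ C, μ.real (s i) ≤ r) : μ.real (⋃ i ∈ C, s i) ≤ C.card * r := by
  have := h.prob
  refine (measureReal_biUnion_finset_le C s).trans ?_
  refine (Finset.sum_le_sum hs).trans ?_
  simp

lemma base_PP (h : GM μ Γ) (hn : 4 ≤ n) (hΓ : ∀ i j, Γ i j ≤ 1) (hd : ∀ i, Γ i i = 1)
    (ho : ∀ i j, i ≠ j → Γ i j ≤ 1 / 2) {β : ℝ} (hβ : 0 < β) {K : ℝ}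
    (hK : K = sqrt (log n) / 16) (hβK : 22 * log n ≤ β * K)
    {a b : ℝ} (ha : 0 ≤ a) (ha' : a ≤ 1 / 4096) (hb : 0 ≤ b) (hab : a ^ 2 + b ^ 2 = 1)
    (C : Finset (Fin n)) (hC : (C.card : ℝ) ≤ (n : ℝ) ^ (1 / 65536 : ℝ))
    (x : Fin n → ℝ) (hx : ‖x‖ ≤ 64 * K) :
    PP μ a b (q β C) x ≤ 3 * (n : ℝ) ^ (-(1 / 65536) : ℝ) := by
  have := h.prob
  have hn0 : 0 < n := by omega
  have hn4 : (4 : ℝ) ≤ n := by exact_mod_cast hn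
  have hnp : (0 : ℝ) < n := by linarith
  have hlog : 0 < log n := log_pos (by linarith)
  have hKp : 0 < K := by rw [hK]; have := sqrt_pos.2 hlog; positivity
  have hK2 : K ^ 2 = log n / 256 := by
    rw [hK, div_pow, sq_sqrt hlog.le]; norm_num
  have hb1 : b ≤ 1 := by nlinarith
  have hb2 : 1 / 2 ≤ b := by nlinarith
  have hax : ∀ i, |a * x i| ≤ K / 64 := fun i => by
    have : |x i| ≤ 64 * K := (norm_le_pi_norm x i).trans hx
    rw [abs_mul, abs_of_nonneg ha]
    calc a * |x i| ≤ 1 / 4096 * (64 * K) := by gcongr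
      _ = K / 64 := by ring
  set A1 : Set (Fin n → ℝ) := {y | F β y ≤ (∫ x, F β x ∂μ) - K / 4} with hA1
  set A2 : Set (Fin n → ℝ) := ⋃ i ∈ C, {y | K / 8 ≤ y i} with hA2
  have mA1 : MeasurableSet A1 := measurableSet_le (F_meas β) measurable_const
  have mA2 : MeasurableSet A2 := Finset.measurableSet_biUnion _ fun i _ =>
    measurableSet_le measurable_const (measurable_pi_apply i)
  have hM := mean_lower h hn hd ho hβ
  rw [← hK] at hM
  have hlb : log n / β ≤ K / 22 := by rw [div_le_iff₀ hβ]; linarith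
  have pt : ∀ y, q β C (a • x + b • y) ≤
      A1.indicator (fun _ => (1 : ℝ)) y + A2.indicator (fun _ => (1 : ℝ)) y +
        (n : ℝ) ^ (-1 : ℝ) := by
    intro y
    have hq := q_le_one hn0 hβ C (a • x + b • y)
    have hn1 : 0 ≤ (n : ℝ) ^ (-1 : ℝ) := by positivity
    by_cases h1 : y ∈ A1
    · have : 0 ≤ A2.indicator (fun _ => (1 : ℝ)) y := Set.indicator_nonneg (fun _ _ => zero_le_one) _
      rw [Set.indicator_of_mem h1]; linarith
    by_cases h2 : y ∈ A2
    · rw [Set.indicator_of_mem h2, Set.indicator_of_notMem h1]; linarith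
    rw [Set.indicator_of_notMem h1, Set.indicator_of_notMem h2]
    have h1' : ∃ i0, K / 2 < y i0 := by
      by_contra hc
      push Not at hc
      apply h1
      have := F_le hn0 hβ y (K / 2) hc
      simp only [hA1, Set.mem_ofPred_eq]
      linarith
    obtain ⟨i0, hi0⟩ := h1'
    have h2' : ∀ i ∈ C, y i < K / 8 := by
      intro i hi
      by_contra hc
      apply h2
      simp only [hA2, Set.mem_iUnion]
      exact ⟨i, hi, not_lt.1 hc⟩
    have hF : -(K / 64) + b * (K / 2) ≤ F β (a • x + b • y) := by
      refine le_trans ?_ (le_F hn0 hβ i0 _)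
      have := (abs_le.1 (hax i0)).1
      simp only [Pi.add_apply, Pi.smul_apply, smul_eq_mul]
      have : b * (K / 2) ≤ b * y i0 := by gcongr
      linarith
    have hp : ∀ i ∈ C, p β i (a • x + b • y) ≤ (n : ℝ) ^ (-2 : ℝ) := by
      intro i hi
      rw [rpow_def_of_pos hnp]
      apply exp_le_exp.2
      have e1 : (a • x + b • y) i ≤ K / 64 + b * (K / 8) := by
        have := (abs_le.1 (hax i)).2
        simp only [Pi.add_apply, Pi.smul_apply, smul_eq_mul]
        have : b * y i ≤ b * (K / 8) := by have := h2' i hi; gcongr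
        linarith
      have e2 : (a • x + b • y) i - F β (a • x + b • y) ≤ - (5 * K / 32) := by nlinarith
      have e3 : β * ((a • x + b • y) i - F β (a • x + b • y)) ≤ β * (- (5 * K / 32)) := by gcongr
      refine e3.trans ?_
      linarith
    have : q β C (a • x + b • y) ≤ n * (n : ℝ) ^ (-2 : ℝ) := by
      calc q β C (a • x + b • y) ≤ ∑ i ∈ C, (n : ℝ) ^ (-2 : ℝ) := Finset.sum_le_sum hp
        _ = C.card * (n : ℝ) ^ (-2 : ℝ) := by simp
        _ ≤ _ := by
          gcongr
          simpa using Finset.card_le_univ C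
    have e : (n : ℝ) * (n : ℝ) ^ (-2 : ℝ) = (n : ℝ) ^ (-1 : ℝ) := by
      rw [← rpow_one_add' hnp.le (by norm_num)]; norm_num
    rw [e] at this
    linarith
  have i1 : Integrable (A1.indicator (fun _ => (1 : ℝ))) μ := (integrable_const 1).indicator mA1
  have i2 : Integrable (A2.indicator (fun _ => (1 : ℝ))) μ := (integrable_const 1).indicator mA2
  have i12 : Integrable (fun y => A1.indicator (fun _ => (1 : ℝ)) y +
    A2.indicator (fun _ => (1 : ℝ)) y) μ := i1.add i2
  have hint : PP μ a b (q β C) x ≤ μ.real A1 + μ.real A2 + (n : ℝ) ^ (-1 : ℝ) := by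
    have := integral_mono (h.int hn0 ((q_eg hn0 hβ C).aff (a • x) b))
      (i12.add (integrable_const ((n : ℝ) ^ (-1 : ℝ)))) pt
    refine this.trans (le_of_eq ?_)
    simp only [Pi.add_apply]
    rw [integral_add i12 (integrable_const _), integral_add i1 i2]
    simp [integral_indicator, mA1, mA2]
  have b1 : μ.real A1 ≤ (n : ℝ) ^ (-(1 / 65536) : ℝ) := by
    refine (tail_F h hn0 hΓ hβ (by positivity : 0 ≤ K / 4)).trans ?_
    rw [rpow_def_of_pos hnp]
    apply exp_le_exp.2
    rw [div_pow, hK2]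
    linarith
  have b2 : μ.real A2 ≤ (n : ℝ) ^ (-(1 / 65536) : ℝ) := by
    refine (real_finset_union h C _ fun i _ => tail_coord h i (by positivity : 0 ≤ K / 8)).trans ?_
    have e : exp (-((K / 8) ^ 2 / 2)) = (n : ℝ) ^ (-(1 / 32768) : ℝ) := by
      rw [rpow_def_of_pos hnp, div_pow, hK2]
      congr 1; ring
    rw [e]
    calc _ ≤ (n : ℝ) ^ (1 / 65536 : ℝ) * (n : ℝ) ^ (-(1 / 32768) : ℝ) := by gcongr
      _ = _ := by rw [← rpow_add hnp]; norm_num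
  have b3 : (n : ℝ) ^ (-1 : ℝ) ≤ (n : ℝ) ^ (-(1 / 65536) : ℝ) :=
    rpow_le_rpow_of_exponent_le (by linarith) (by norm_num)
  linarith

lemma tail_norm (h : GM μ Γ) {u : ℝ} (hu : 0 ≤ u) :
    μ.real {x | u < ‖x‖} ≤ n * (2 * exp (-(u ^ 2 / 2))) := by
  have := h.prob
  have hsub : {x : Fin n → ℝ | u < ‖x‖} ⊆
      ⋃ i ∈ (Finset.univ : Finset (Fin n)), ({x | u ≤ x i} ∪ {x | x i ≤ -u}) := by
    intro x hx
    simp only [Set.mem_ofPred_eq] at hx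
    by_contra hc
    have : ‖x‖ ≤ u := by
      rw [pi_norm_le_iff_of_nonneg hu]
      intro i
      rw [Real.norm_eq_abs, abs_le]
      simp only [Finset.mem_univ, Set.iUnion_true, Set.mem_iUnion, Set.mem_union,
        Set.mem_ofPred_eq, not_exists, not_or, not_le] at hc
      exact ⟨(hc i).2.le, (hc i).1.le⟩
    linarith
  refine (measureReal_mono hsub (measure_ne_top _ _)).trans ?_
  have := real_finset_union h Finset.univ (fun i => {x | u ≤ x i} ∪ {x | x i ≤ -u})
    (r := 2 * exp (-(u ^ 2 / 2))) fun i _ => by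
      refine (measureReal_union_le _ _).trans ?_
      linarith [tail_coord h i hu, tail_coord' h i hu]
  simpa using this

lemma base_B (h : GM μ Γ) (hn : 4 ≤ n) (hΓ : ∀ i j, Γ i j ≤ 1) {β : ℝ} (hβ : 0 < β)
    {θ : ℝ} (hθ : θ ^ 2 ≤ log n) {B : Set (Fin n → ℝ)}
    (hB : B = {x | 4 * sqrt (log n) < ‖x‖}) :
    ∫ x, exp (θ * F β x) * B.indicator (fun _ => (1 : ℝ)) x ∂μ ≤
      (n : ℝ)⁻¹ * ∫ x, exp (θ * F β x) ∂μ := by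
  have := h.prob
  have hn0 : 0 < n := by omega
  have hn4 : (4 : ℝ) ≤ n := by exact_mod_cast hn
  have hnp : (0 : ℝ) < n := by linarith
  have hlog : 0 < log n := log_pos (by linarith)
  have mB : MeasurableSet B := by rw [hB]; exact measurableSet_lt measurable_const measurable_norm
  have iB : Integrable (B.indicator (fun _ => (1 : ℝ))) μ := (integrable_const 1).indicator mB
  set M := ∫ x, F β x ∂μ with hM
  set A := ∫ x, exp (θ * F β x) ∂μ with hA
  have hj : exp (θ * M) ≤ A := jensen h hn0 hβ θ
  have hPB : μ.real B ≤ 2 * (n : ℝ)⁻¹ ^ 7 := by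
    rw [hB]
    refine (tail_norm h (by positivity)).trans ?_
    rw [mul_pow, sq_sqrt hlog.le]
    have : exp (-(4 ^ 2 * log n / 2)) = (n : ℝ)⁻¹ ^ 8 := by
      have : -(4 ^ 2 * log n / 2) = (8 : ℕ) * (- log n) := by push_cast; ring
      rw [this, Real.exp_nat_mul, Real.exp_neg, exp_log hnp]
    rw [this]
    apply le_of_eq
    field_simp
  set c := (n : ℝ)⁻¹ ^ 3 * exp (-(θ * M)) with hc
  have hcp : 0 < c := by positivity
  have hcinv : c⁻¹ = n ^ 3 * exp (θ * M) := by
    rw [hc, Real.exp_neg, mul_inv, inv_inv, inv_pow, inv_inv]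
  have pt : ∀ x, exp (θ * F β x) * B.indicator (fun _ => (1 : ℝ)) x ≤
      c / 2 * exp ((2 * θ) * F β x) + c⁻¹ / 2 * B.indicator (fun _ => (1 : ℝ)) x := by
    intro x
    have e : exp ((2 * θ) * F β x) = exp (θ * F β x) ^ 2 := by
      rw [← Real.exp_nat_mul]; congr 1; push_cast; ring
    rw [e]
    by_cases hx : x ∈ B
    · rw [Set.indicator_of_mem hx]
      have h1 : c⁻¹ * c = 1 := inv_mul_cancel₀ hcp.ne'
      have h2 : 0 ≤ c⁻¹ * (c * exp (θ * F β x) - 1) ^ 2 := by positivity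
      have h3 : c⁻¹ * (c * exp (θ * F β x) - 1) ^ 2 =
        (c⁻¹ * c) * c * exp (θ * F β x) ^ 2 - 2 * (c⁻¹ * c) * exp (θ * F β x) + c⁻¹ := by ring
      rw [h3, h1] at h2
      linarith
    · rw [Set.indicator_of_notMem hx]
      have := exp_pos (θ * F β x)
      simp only [mul_zero, add_zero]
      positivity
  have i1 : Integrable (fun x => exp (θ * F β x) * B.indicator (fun _ => (1 : ℝ)) x) μ := by
    refine h.int hn0 (EG.of_le (expF_eg hn0 hβ θ) ?_ ?_)
    · exact ((F_meas β).const_mul θ).exp.mul (measurable_const.indicator mB)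
    · intro x
      rw [abs_mul]
      refine mul_le_of_le_one_right (abs_nonneg _) ?_
      by_cases hx : x ∈ B <;> simp [hx]
  have i2 := (h.int hn0 (expF_eg hn0 hβ (2 * θ))).const_mul (c / 2)
  have i3 := iB.const_mul (c⁻¹ / 2)
  have h1 := integral_mono i1 (i2.add i3) pt
  have h2 : ∫ x, (c / 2 * exp ((2 * θ) * F β x) + c⁻¹ / 2 * B.indicator (fun _ => (1 : ℝ)) x) ∂μ =
      c / 2 * (∫ x, exp ((2 * θ) * F β x) ∂μ) + c⁻¹ / 2 * μ.real B := by
    rw [integral_add i2 i3, integral_const_mul, integral_const_mul]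
    simp [integral_indicator, mB]
  have h1' : _ ≤ c / 2 * (∫ x, exp ((2 * θ) * F β x) ∂μ) + c⁻¹ / 2 * μ.real B := h1.trans h2.le
  refine h1'.trans ?_
  have b1 : c * (∫ x, exp ((2 * θ) * F β x) ∂μ) ≤ (n : ℝ)⁻¹ * A := by
    have := herbst' h hn0 hΓ hβ (2 * θ)
    have e1 : exp (2 * θ * M + (2 * θ) ^ 2 / 2) ≤ exp (2 * (θ * M)) * n ^ 2 := by
      have : exp (2 * log n) = (n : ℝ) ^ 2 := by
        have := Real.exp_nat_mul (log n) 2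
        rw [exp_log hnp] at this
        simpa using this
      rw [← this, ← Real.exp_add]
      apply exp_le_exp.2
      nlinarith
    calc c * (∫ x, exp ((2 * θ) * F β x) ∂μ) ≤ c * (exp (2 * (θ * M)) * n ^ 2) := by
          gcongr; exact this.trans e1
      _ = (n : ℝ)⁻¹ * (exp (-(θ * M)) * exp (2 * (θ * M))) := by rw [hc]; field_simp
      _ = (n : ℝ)⁻¹ * exp (θ * M) := by rw [← Real.exp_add]; ring_nf
      _ ≤ _ := by gcongr
  have b2 : c⁻¹ * μ.real B ≤ (n : ℝ)⁻¹ * A := by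
    calc c⁻¹ * μ.real B ≤ (n ^ 3 * exp (θ * M)) * (2 * (n : ℝ)⁻¹ ^ 7) := by
          rw [hcinv]; gcongr
      _ = (2 * (n : ℝ)⁻¹ ^ 3) * ((n : ℝ)⁻¹ * exp (θ * M)) := by field_simp
      _ ≤ 1 * ((n : ℝ)⁻¹ * exp (θ * M)) := by
          have : (n : ℝ)⁻¹ ≤ 1 / 4 := by rw [inv_le_comm₀ hnp (by norm_num)]; linarith
          have h3 : (n : ℝ)⁻¹ ^ 3 ≤ (1 / 4) ^ 3 := by gcongr
          gcongr
          have h4 : ((1 : ℝ) / 4) ^ 3 = 1 / 64 := by norm_num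
          linarith
      _ ≤ _ := by rw [one_mul]; gcongr
  linarith

noncomputable def G (β θ : ℝ) (C : Finset (Fin n)) (x : Fin n → ℝ) : ℝ :=
  q β C x * exp (θ / 2 * F β x)

lemma G_eg (hn : 0 < n) {β : ℝ} (hβ : 0 < β) (θ : ℝ) (C : Finset (Fin n)) : EG (G β θ C) :=
  (q_eg hn hβ C).mul (expF_eg hn hβ _)

lemma base_S (h : GM μ Γ) (hn : 4 ≤ n) (hΓ : ∀ i j, Γ i j ≤ 1) (hd : ∀ i, Γ i i = 1)
    (ho : ∀ i j, i ≠ j → Γ i j ≤ 1 / 2) {β : ℝ} (hβ : 0 < β)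
    (hβK : 22 * log n ≤ β * (sqrt (log n) / 16))
    {a b : ℝ} (ha : 0 ≤ a) (ha' : a ≤ 1 / 4096) (hb : 0 ≤ b) (hab : a ^ 2 + b ^ 2 = 1)
    {ι : Type*} (s : Finset ι) (C : ι → Finset (Fin n))
    (hC : ∀ k, ((C k).card : ℝ) ≤ (n : ℝ) ^ (1 / 65536 : ℝ))
    (hsum : ∀ x, ∑ k ∈ s, q β (C k) x = 1) {θ : ℝ} (hθ : θ ^ 2 ≤ log n) :
    ∑ k ∈ s, J μ a b (G β θ (C k)) (G β θ (C k)) ≤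
      (4 * (n : ℝ) ^ (-(1 / 65536) : ℝ)) * ∫ x, exp (θ * F β x) ∂μ := by
  have := h.prob
  have hn0 : 0 < n := by omega
  have hn4 : (4 : ℝ) ≤ n := by exact_mod_cast hn
  have hnp : (0 : ℝ) < n := by linarith
  set B : Set (Fin n → ℝ) := {x | 4 * sqrt (log n) < ‖x‖} with hB
  have mB : MeasurableSet B := by rw [hB]; exact measurableSet_lt measurable_const measurable_norm
  set r := 3 * (n : ℝ) ^ (-(1 / 65536) : ℝ) with hr
  have hrp : 0 ≤ r := by positivity
  have qe : ∀ k, EG (fun x => q β (C k) x * exp (θ * F β x)) := fun k =>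
    (q_eg hn0 hβ _).mul (expF_eg hn0 hβ θ)
  have eB : EG (B.indicator (fun _ => (1 : ℝ))) := by
    refine EG.of_le (EG.const 1) (measurable_const.indicator mB) fun x => ?_
    by_cases hx : x ∈ B <;> simp [hx]
  have hPP : ∀ k x, PP μ a b (q β (C k)) x ≤ r + B.indicator (fun _ => (1 : ℝ)) x := by
    intro k x
    by_cases hx : x ∈ B
    · rw [Set.indicator_of_mem hx]
      have : PP μ a b (q β (C k)) x ≤ ∫ y, (1 : ℝ) ∂μ :=
        integral_mono (h.int hn0 ((q_eg hn0 hβ (C k)).aff (a • x) b)) (integrable_const 1)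
          fun y => q_le_one hn0 hβ _ _
      simp at this
      linarith
    · rw [Set.indicator_of_notMem hx, add_zero]
      refine base_PP h hn hΓ hd ho hβ rfl hβK ha ha' hb hab (C k) (hC k) x ?_
      simp only [hB, Set.mem_ofPred_eq, not_lt] at hx
      linarith
  have hJ : ∀ k, J μ a b (G β θ (C k)) (G β θ (C k)) ≤
      ∫ x, q β (C k) x * exp (θ * F β x) * (r + B.indicator (fun _ => (1 : ℝ)) x) ∂μ := by
    intro k
    have e1 : J μ a b (G β θ (C k)) (G β θ (C k)) ≤
        1 / 2 * J μ a b (fun x => q β (C k) x * exp (θ * F β x)) (q β (C k)) +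
        1 / 2 * J μ a b (q β (C k)) (fun x => q β (C k) x * exp (θ * F β x)) := by
      unfold J
      have i1 := (h.int2 hn0 (J_eg (qe k) (q_eg hn0 hβ (C k)) a b)).const_mul (1 / 2)
      have i2 := (h.int2 hn0 (J_eg (q_eg hn0 hβ (C k)) (qe k) a b)).const_mul (1 / 2)
      rw [← integral_const_mul, ← integral_const_mul, ← integral_add i1 i2]
      refine integral_mono (h.int2 hn0 (J_eg (G_eg hn0 hβ θ (C k)) (G_eg hn0 hβ θ (C k)) a b))
        (i1.add i2) fun z => ?_
      simp only [G]
      have ee : ∀ x : Fin n → ℝ, exp (θ * F β x) = exp (θ / 2 * F β x) ^ 2 := fun x => by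
        rw [← Real.exp_nat_mul]; congr 1; push_cast; ring
      rw [ee, ee]
      have hq := mul_nonneg (q_nonneg β (C k) z.1) (q_nonneg β (C k) (a • z.1 + b • z.2))
      nlinarith [mul_nonneg hq (sq_nonneg (exp (θ / 2 * F β z.1) -
        exp (θ / 2 * F β (a • z.1 + b • z.2))))]
    rw [h.J_symm hab (q_eg hn0 hβ (C k)) (qe k)] at e1
    have e2 : J μ a b (G β θ (C k)) (G β θ (C k)) ≤
      J μ a b (fun x => q β (C k) x * exp (θ * F β x)) (q β (C k)) := by linarith
    refine e2.trans ?_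
    rw [h.J_iter hn0 a b (qe k) (q_eg hn0 hβ (C k))]
    refine integral_mono (h.int hn0 ((qe k).mul (h.PP_eg hn0 a b (q_eg hn0 hβ (C k)))))
      (h.int hn0 ((qe k).mul ((EG.const r).add eB))) fun x => ?_
    exact mul_le_mul_of_nonneg_left (hPP k x) (mul_nonneg (q_nonneg _ _ _) (exp_pos _).le)
  have h1 : ∑ k ∈ s, J μ a b (G β θ (C k)) (G β θ (C k)) ≤
      ∫ x, exp (θ * F β x) * (r + B.indicator (fun _ => (1 : ℝ)) x) ∂μ := by
    refine (Finset.sum_le_sum fun k _ => hJ k).trans (le_of_eq ?_)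
    rw [← integral_finsetSum _ fun k _ => h.int hn0 ((qe k).mul ((EG.const r).add eB))]
    congr 1
    funext x
    rw [← Finset.sum_mul, ← Finset.sum_mul, hsum, one_mul]
  refine h1.trans ?_
  have h2 : ∫ x, exp (θ * F β x) * (r + B.indicator (fun _ => (1 : ℝ)) x) ∂μ =
    r * (∫ x, exp (θ * F β x) ∂μ) +
      ∫ x, exp (θ * F β x) * B.indicator (fun _ => (1 : ℝ)) x ∂μ := by
    rw [← integral_const_mul, ← integral_add (h.int hn0 ((expF_eg hn0 hβ θ).const_mul r))
      (h.int hn0 ((expF_eg hn0 hβ θ).mul eB))]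
    congr 1
    funext x
    ring
  rw [h2]
  have h3 := base_B h hn hΓ hβ hθ hB
  have h4 : (n : ℝ)⁻¹ ≤ (n : ℝ) ^ (-(1 / 65536) : ℝ) := by
    rw [← rpow_neg_one]
    exact rpow_le_rpow_of_exponent_le (by linarith) (by norm_num)
  have hA : 0 ≤ ∫ x, exp (θ * F β x) ∂μ := integral_nonneg fun x => (exp_pos _).le
  have h5 := mul_le_mul_of_nonneg_right h4 hA
  rw [hr]
  linarith

end SGS

open MeasureTheory ProbabilityTheory Real

namespace SGS
open Filter Topology

variable {n : ℕ} {μ : Measure (Fin n → ℝ)} {Γ : Fin n → Fin n → ℝ}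

lemma GM.J_nonneg (h : GM μ Γ) (hn : 0 < n) {a b : ℝ} (ha : 0 ≤ a)
    (hab : a ^ 2 + b ^ 2 = 1) {f : (Fin n → ℝ) → ℝ} (hf : EG f) : 0 ≤ J μ a b f f := by
  have ha1 : a ≤ 1 := by nlinarith
  have h1 : sqrt a ^ 2 = a := sq_sqrt ha
  have h2 : sqrt (1 - a) ^ 2 = 1 - a := sq_sqrt (by linarith)
  rw [← h.J_PP hn (a := sqrt a) (b := sqrt (1 - a)) (c := a) (d := b) (by linarith) h1.symm
    (by have : sqrt a ^ 4 = (sqrt a ^ 2) ^ 2 := by ring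
        rw [this, h1]; linarith) hf]
  exact integral_nonneg fun x => sq_nonneg _

lemma GM.J_le (h : GM μ Γ) (hn : 0 < n) {a b : ℝ} (ha : 0 ≤ a)
    (hab : a ^ 2 + b ^ 2 = 1) {f g : (Fin n → ℝ) → ℝ} (hf : EG f) (hg : EG g) :
    J μ a b f g ≤ (J μ a b f f + J μ a b g g) / 2 := by
  have h1 := h.J_nonneg hn ha hab (hf.sub hg)
  have e : J μ a b (fun x => f x - g x) (fun x => f x - g x) =
      J μ a b f f - J μ a b f g - (J μ a b g f - J μ a b g g) := by
    unfold J
    have i1 := h.int2 hn (J_eg hf hf a b)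
    have i2 := h.int2 hn (J_eg hf hg a b)
    have i3 := h.int2 hn (J_eg hg hf a b)
    have i4 := h.int2 hn (J_eg hg hg a b)
    have i12 : Integrable (fun z : (Fin n → ℝ) × (Fin n → ℝ) =>
      f z.1 * f (a • z.1 + b • z.2) - f z.1 * g (a • z.1 + b • z.2)) (μ.prod μ) := i1.sub i2
    have i34 : Integrable (fun z : (Fin n → ℝ) × (Fin n → ℝ) =>
      g z.1 * f (a • z.1 + b • z.2) - g z.1 * g (a • z.1 + b • z.2)) (μ.prod μ) := i3.sub i4
    rw [← integral_sub i1 i2, ← integral_sub i3 i4, ← integral_sub i12 i34]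
    congr 1
    funext z
    ring
  rw [e, h.J_symm hab hg hf] at h1
  linarith

lemma GM.J_fin (h : GM μ Γ) (hn : 0 < n) (a b : ℝ) {ι κ : Type*} (s : Finset ι) (t : Finset κ)
    {f : ι → (Fin n → ℝ) → ℝ} {g : κ → (Fin n → ℝ) → ℝ} (hf : ∀ i, EG (f i)) (hg : ∀ i, EG (g i)) :
    J μ a b (fun x => ∑ i ∈ s, f i x) (fun x => ∑ j ∈ t, g j x) =
      ∑ i ∈ s, ∑ j ∈ t, J μ a b (f i) (g j) := by
  unfold J
  have hi : ∀ i j, Integrable (fun z : (Fin n → ℝ) × (Fin n → ℝ) =>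
    f i z.1 * g j (a • z.1 + b • z.2)) (μ.prod μ) := fun i j => h.int2 hn (J_eg (hf i) (hg j) a b)
  simp only [Finset.sum_mul_sum]
  rw [integral_finsetSum _ fun i _ => integrable_finsetSum _ fun j _ => hi i j]
  refine Finset.sum_congr rfl fun i _ => ?_
  rw [integral_finsetSum _ fun j _ => hi i j]

lemma GM.J_pos (h : GM μ Γ) {a b : ℝ} {f g : (Fin n → ℝ) → ℝ} (hf : ∀ x, 0 ≤ f x)
    (hg : ∀ x, 0 ≤ g x) : 0 ≤ J μ a b f g :=
  integral_nonneg fun z => mul_nonneg (hf _) (hg _)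

/-- Cauchy-Schwarz -/
lemma GM.J_self_le (h : GM μ Γ) (hn : 0 < n) {a b : ℝ} (hab : a ^ 2 + b ^ 2 = 1)
    {f : (Fin n → ℝ) → ℝ} (hf : EG f) : J μ a b f f ≤ ∫ x, f x * f x ∂μ := by
  have hff := hf.mul hf
  have i1 := (h.int2 hn hff.fst).const_mul (1 / 2)
  have i2 := (h.int2 hn (hff.lin a b)).const_mul (1 / 2)
  have : J μ a b f f ≤ ∫ z, (1 / 2 * (f z.1 * f z.1) + 1 / 2 *
      (f (a • z.1 + b • z.2) * f (a • z.1 + b • z.2))) ∂(μ.prod μ) := by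
    refine integral_mono (h.int2 hn (J_eg hf hf a b)) (i1.add i2) fun z => ?_
    simp only [Pi.add_apply]
    nlinarith [sq_nonneg (f z.1 - f (a • z.1 + b • z.2))]
  refine this.trans (le_of_eq ?_)
  rw [integral_add i1 i2, integral_const_mul, integral_const_mul,
    h.fst_int (fun x => f x * f x), h.snd_int hn hab hff]
  ring

lemma step_J (h : GM μ Γ) (hn : 0 < n) {a b c d : ℝ} (hab : a ^ 2 + b ^ 2 = 1)
    (hc : c = a ^ 2) (hd : d ^ 2 = 1 - a ^ 4) {l : ℝ} (hl : 0 < l)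
    {g : (Fin n → ℝ) → ℝ} (hg : EG g) :
    J μ a b g g ≤ l / 2 * (∫ x, g x * g x ∂μ) + l⁻¹ / 2 * J μ c d g g := by
  rw [← h.J_PP hn hab hc hd hg, h.J_iter hn a b hg hg, ← integral_const_mul, ← integral_const_mul]
  have hP := h.PP_eg hn a b hg
  have i1 := (h.int hn (hg.mul hg)).const_mul (l / 2)
  have i2 : Integrable (fun x => l⁻¹ / 2 * PP μ a b g x ^ 2) μ := by
    have := (h.int hn (hP.mul hP)).const_mul (l⁻¹ / 2)
    simpa only [sq] using this
  rw [← integral_add i1 i2]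
  refine integral_mono (h.int hn (hg.mul hP)) (i1.add i2) fun x => ?_
  change g x * PP μ a b g x ≤ l / 2 * (g x * g x) + l⁻¹ / 2 * PP μ a b g x ^ 2
  have h1 : l⁻¹ * l = 1 := inv_mul_cancel₀ hl.ne'
  have h2 : 0 ≤ l⁻¹ * (l * g x - PP μ a b g x) ^ 2 := by positivity
  have h3 : l⁻¹ * (l * g x - PP μ a b g x) ^ 2 =
    (l⁻¹ * l) * l * g x ^ 2 - 2 * (l⁻¹ * l) * (g x * PP μ a b g x) + l⁻¹ * PP μ a b g x ^ 2 := by ring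
  rw [h3, h1] at h2
  linarith

section S
variable {ι : Type*} (s : Finset ι) (C : ι → Finset (Fin n)) {β : ℝ} (θ : ℝ)

lemma G_sq (h : GM μ Γ) (hn : 0 < n) (hβ : 0 < β) (hsum : ∀ x, ∑ k ∈ s, q β (C k) x = 1) :
    ∑ k ∈ s, ∫ x, G β θ (C k) x * G β θ (C k) x ∂μ ≤ ∫ x, exp (θ * F β x) ∂μ := by
  have hg := fun k => h.int hn ((G_eg hn hβ θ (C k)).mul (G_eg hn hβ θ (C k)))
  rw [← integral_finsetSum _ fun k _ => hg k]
  refine integral_mono (integrable_finsetSum _ fun k _ => hg k) (h.int hn (expF_eg hn hβ θ))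
    fun x => ?_
  have ee : exp (θ * F β x) = exp (θ / 2 * F β x) ^ 2 := by
    rw [← Real.exp_nat_mul]; congr 1; push_cast; ring
  calc ∑ k ∈ s, G β θ (C k) x * G β θ (C k) x ≤ ∑ k ∈ s, q β (C k) x * exp (θ * F β x) := by
        refine Finset.sum_le_sum fun k _ => ?_
        simp only [G, ee]
        have h0 := q_nonneg β (C k) x
        have h1 := q_le_one hn hβ (C k) x
        have : q β (C k) x * q β (C k) x ≤ q β (C k) x := by nlinarith
        nlinarith [sq_nonneg (exp (θ / 2 * F β x))]
    _ = exp (θ * F β x) := by rw [← Finset.sum_mul, hsum, one_mul]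

noncomputable def SS (μ : Measure (Fin n → ℝ)) (β : ℝ) (a b : ℝ) : ℝ :=
  ∑ k ∈ s, J μ a b (G β θ (C k)) (G β θ (C k))

lemma SS_pow (h : GM μ Γ) (hn : 0 < n) (hβ : 0 < β) (hsum : ∀ x, ∑ k ∈ s, q β (C k) x = 1)
    {l : ℝ} (hbase : ∀ a b, 0 ≤ a → a ≤ 1 / 4096 → 0 ≤ b → a ^ 2 + b ^ 2 = 1 →
      SS s C θ μ β a b ≤ (∫ x, exp (θ * F β x) ∂μ) * exp (-l)) (k : ℕ) :
    ∀ a b, 0 ≤ a → a ^ (2 ^ k) ≤ 1 / 4096 → 0 ≤ b → a ^ 2 + b ^ 2 = 1 →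
      SS s C θ μ β a b ≤ (∫ x, exp (θ * F β x) ∂μ) * exp (-(l / 2 ^ k)) := by
  induction k with
  | zero => simpa using hbase
  | succ k ih =>
    intro a b ha hak hb hab
    set A := ∫ x, exp (θ * F β x) ∂μ with hA
    have ha1 : a ≤ 1 := by nlinarith
    have ha4 : 0 ≤ 1 - a ^ 4 := by
      have : a ^ 4 ≤ 1 := pow_le_one₀ ha ha1
      linarith
    have hd : sqrt (1 - a ^ 4) ^ 2 = 1 - a ^ 4 := sq_sqrt ha4
    have h1 := ih (a ^ 2) (sqrt (1 - a ^ 4)) (by positivity)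
      (by rw [← pow_mul, ← pow_succ']; exact hak) (sqrt_nonneg _) (by rw [hd]; ring)
    set y := l / 2 ^ (k + 1) with hy
    have hy2 : l / 2 ^ k = 2 * y := by rw [hy, pow_succ]; field_simp
    rw [hy2] at h1
    have h2 : SS s C θ μ β a b ≤ exp (-y) / 2 * A +
        (exp (-y))⁻¹ / 2 * SS s C θ μ β (a ^ 2) (sqrt (1 - a ^ 4)) := by
      calc SS s C θ μ β a b ≤ ∑ k ∈ s, (exp (-y) / 2 * (∫ x, G β θ (C k) x * G β θ (C k) x ∂μ) +
            (exp (-y))⁻¹ / 2 * J μ (a ^ 2) (sqrt (1 - a ^ 4)) (G β θ (C k)) (G β θ (C k))) :=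
            Finset.sum_le_sum fun k _ => step_J h hn hab rfl hd (exp_pos _) (G_eg hn hβ θ (C k))
        _ = exp (-y) / 2 * (∑ k ∈ s, ∫ x, G β θ (C k) x * G β θ (C k) x ∂μ) +
            (exp (-y))⁻¹ / 2 * SS s C θ μ β (a ^ 2) (sqrt (1 - a ^ 4)) := by
            rw [Finset.sum_add_distrib, ← Finset.mul_sum, ← Finset.mul_sum, SS]
        _ ≤ _ := by
            gcongr
            exact G_sq s C θ h hn hβ hsum
    have h3 : (exp (-y))⁻¹ / 2 * SS s C θ μ β (a ^ 2) (sqrt (1 - a ^ 4)) ≤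
        (exp (-y))⁻¹ / 2 * (A * exp (-(2 * y))) := by gcongr
    have h4 : (exp (-y))⁻¹ / 2 * (A * exp (-(2 * y))) = exp (-y) / 2 * A := by
      have : exp (-(2 * y)) = exp (-y) * exp (-y) := by rw [← Real.exp_add]; ring_nf
      rw [this]; field_simp
    linarith

lemma SS_lin (h : GM μ Γ) (hn : 0 < n) (hβ : 0 < β) (hsum : ∀ x, ∑ k ∈ s, q β (C k) x = 1)
    {l : ℝ} (hl : 0 ≤ l) (hbase : ∀ a b, 0 ≤ a → a ≤ 1 / 4096 → 0 ≤ b → a ^ 2 + b ^ 2 = 1 →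
      SS s C θ μ β a b ≤ (∫ x, exp (θ * F β x) ∂μ) * exp (-l)) :
    ∀ a b, 0 ≤ a → 0 ≤ b → a ^ 2 + b ^ 2 = 1 →
      SS s C θ μ β a b ≤ (∫ x, exp (θ * F β x) ∂μ) * exp (-(l / 18 * (1 - a))) := by
  intro a b ha hb hab
  have hA0 : 0 ≤ ∫ x, exp (θ * F β x) ∂μ := integral_nonneg fun x => (exp_pos _).le
  have ha1 : a ≤ 1 := by nlinarith
  rcases ha1.eq_or_lt with rfl | ha1
  · have hb0 : b = 0 := by nlinarith
    subst hb0
    simp only [sub_self, mul_zero, neg_zero, exp_zero, mul_one]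
    refine le_trans (Finset.sum_le_sum fun k _ => ?_) (G_sq s C θ h hn hβ hsum)
    exact h.J_self_le hn hab (G_eg hn hβ θ (C k))
  · have hex : ∃ k : ℕ, 9 ≤ (1 - a) * 2 ^ k := by
      obtain ⟨k, hk⟩ := pow_unbounded_of_one_lt (9 / (1 - a)) (by norm_num : (1 : ℝ) < 2)
      refine ⟨k, ?_⟩
      rw [div_lt_iff₀ (by linarith)] at hk
      linarith
    classical
    set k := Nat.find hex with hk
    have hk1 := Nat.find_spec hex
    rw [← hk] at hk1
    have hk0 : k ≠ 0 := by
      intro h0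
      rw [h0] at hk1
      norm_num at hk1
      linarith
    obtain ⟨k', hk'⟩ := Nat.exists_eq_succ_of_ne_zero hk0
    have hlt : (1 - a) * 2 ^ k' < 9 := by
      have := Nat.find_min hex (m := k') (by omega)
      linarith
    have hpow : a ^ (2 ^ k) ≤ 1 / 4096 := by
      have e1 : a ≤ exp (-(1 - a)) := by
        have := Real.add_one_le_exp (-(1 - a)); linarith
      calc a ^ (2 ^ k) ≤ exp (-(1 - a)) ^ (2 ^ k) := by gcongr
        _ = exp (-((1 - a) * 2 ^ k)) := by
          rw [← Real.exp_nat_mul]; congr 1; push_cast; ring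
        _ ≤ exp (-9) := by apply exp_le_exp.2; linarith
        _ ≤ 1 / 4096 := by
          rw [Real.exp_neg, one_div]
          apply inv_anti₀ (by norm_num)
          have := Real.exp_one_gt_d9
          have e : exp 9 = exp 1 ^ 9 := by rw [← Real.exp_nat_mul]; norm_num
          rw [e]
          calc (4096 : ℝ) ≤ 2.7 ^ 9 := by norm_num
            _ ≤ _ := by gcongr; linarith
    refine (SS_pow s C θ h hn hβ hsum hbase k a b ha hpow hb hab).trans ?_
    gcongr
    rw [hk', Nat.succ_eq_add_one, pow_succ]
    have h2 : (0 : ℝ) < 2 ^ k' := by positivity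
    rw [le_div_iff₀ (by positivity)]
    nlinarith
end S

lemma near_card (N k : ℕ) :
    ∑ l ∈ Finset.range N, (if k ≤ l + 1 ∧ l ≤ k + 1 then (1 : ℝ) else 0) ≤ 3 := by
  rw [Finset.sum_boole]
  have : (Finset.range N).filter (fun l => k ≤ l + 1 ∧ l ≤ k + 1) ⊆ {k - 1, k, k + 1} := by
    intro l hl
    simp only [Finset.mem_filter, Finset.mem_insert, Finset.mem_singleton] at hl ⊢
    omega
  exact_mod_cast (Finset.card_le_card this).trans Finset.card_le_three

lemma near_sum (N : ℕ) (T : ℕ → ℕ → ℝ) (hT : ∀ k, 0 ≤ T k k)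
    (hTle : ∀ k l, T k l ≤ (T k k + T l l) / 2) :
    ∑ k ∈ Finset.range N, ∑ l ∈ Finset.range N,
      (if k ≤ l + 1 ∧ l ≤ k + 1 then (1 : ℝ) else 0) * T k l ≤
      3 * ∑ k ∈ Finset.range N, T k k := by
  set e : ℕ → ℕ → ℝ := fun k l => if k ≤ l + 1 ∧ l ≤ k + 1 then (1 : ℝ) else 0 with he
  have he0 : ∀ k l, 0 ≤ e k l := fun k l => by simp only [he]; split_ifs <;> norm_num
  have hes : ∀ k l, e k l = e l k := fun k l => by simp only [he, and_comm]
  have h1 : ∑ k ∈ Finset.range N, ∑ l ∈ Finset.range N, e k l * T k k ≤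
      3 * ∑ k ∈ Finset.range N, T k k := by
    rw [Finset.mul_sum]
    refine Finset.sum_le_sum fun k _ => ?_
    rw [← Finset.sum_mul]
    exact mul_le_mul_of_nonneg_right (near_card N k) (hT k)
  have h2 : ∑ k ∈ Finset.range N, ∑ l ∈ Finset.range N, e k l * T l l ≤
      3 * ∑ k ∈ Finset.range N, T k k := by
    rw [Finset.sum_comm]
    simp only [hes _]
    refine le_trans (le_of_eq ?_) h1
    refine Finset.sum_congr rfl fun k _ => Finset.sum_congr rfl fun l _ => ?_
    rw [hes]
  calc _ ≤ ∑ k ∈ Finset.range N, ∑ l ∈ Finset.range N,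
        (e k l * T k k + e k l * T l l) / 2 := by
        refine Finset.sum_le_sum fun k _ => Finset.sum_le_sum fun l _ => ?_
        have := mul_le_mul_of_nonneg_left (hTle k l) (he0 k l)
        linarith
    _ = ((∑ k ∈ Finset.range N, ∑ l ∈ Finset.range N, e k l * T k k) +
        ∑ k ∈ Finset.range N, ∑ l ∈ Finset.range N, e k l * T l l) / 2 := by
        simp only [← Finset.sum_div, Finset.sum_add_distrib]
    _ ≤ _ := by linarith

end SGS

open MeasureTheory ProbabilityTheory Real

namespace SGS
open Filter Topology

variable {n : ℕ} {μ : Measure (Fin n → ℝ)} {Γ : Fin n → Fin n → ℝ}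

noncomputable def uu (β θ : ℝ) (i : Fin n) (x : Fin n → ℝ) : ℝ := exp (θ / 2 * F β x) * p β i x

lemma uu_eg (hn : 0 < n) {β : ℝ} (hβ : 0 < β) (θ : ℝ) (i : Fin n) : EG (uu β θ i) :=
  (expF_eg hn hβ _).mul (p_eg hn hβ i)

lemma uu_nonneg (β θ : ℝ) (i : Fin n) (x : Fin n → ℝ) : 0 ≤ uu β θ i x :=
  mul_nonneg (exp_pos _).le (p_pos _ _ _).le

lemma G_uu (β θ : ℝ) (C : Finset (Fin n)) : G β θ C = fun x => ∑ i ∈ C, uu β θ i x := by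
  funext x
  simp only [G, q, uu, ← Finset.mul_sum]
  ring

lemma J_const (a b c d : ℝ) (f g : (Fin n → ℝ) → ℝ) :
    J μ a b (fun x => c * f x) (fun x => d * g x) = c * d * J μ a b f g := by
  unfold J
  rw [← integral_const_mul]
  congr 1; funext z; ring

lemma cov_exp (h : GM μ Γ) (hn : 0 < n) {β : ℝ} (hβ : 0 < β) (θ : ℝ)
    (B B' : ℝ → ℝ) (hB : ∀ r, HasDerivAt B (B' r) r)
    (hle : ∀ a b, 0 ≤ a → 0 ≤ b → a ^ 2 + b ^ 2 = 1 →
      ∑ j, ∑ i, Γ j i * J μ a b (uu β θ i) (uu β θ j) ≤ B' a) :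
    ∫ x, exp (θ * F β x) ∂μ - (∫ x, exp (θ / 2 * F β x) ∂μ) ^ 2 ≤ θ ^ 2 / 4 * (B 1 - B 0) := by
  have := h.cov_le hn (expF_eg hn hβ (θ / 2)) (fun i => (uu_eg hn hβ θ i).const_mul (θ / 2))
    (expF_grad hn hβ (θ / 2)) (expF_eg hn hβ (θ / 2))
    (fun i => (uu_eg hn hβ θ i).const_mul (θ / 2))
    (expF_grad hn hβ (θ / 2)) (fun r => θ ^ 2 / 4 * B r) (fun r => θ ^ 2 / 4 * B' r)
    (fun r => (hB r).const_mul _) (fun a b ha hb hab => by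
      simp only [J_const]
      have e := mul_le_mul_of_nonneg_left (hle a b ha hb hab) (by positivity : 0 ≤ θ ^ 2 / 4)
      refine le_trans (le_of_eq ?_) e
      rw [Finset.mul_sum]
      refine Finset.sum_congr rfl fun j _ => ?_
      rw [Finset.mul_sum]
      refine Finset.sum_congr rfl fun i _ => ?_
      ring)
  have e : ∀ x : Fin n → ℝ, exp (θ / 2 * F β x) * exp (θ / 2 * F β x) = exp (θ * F β x) := fun x => by
    rw [← Real.exp_add]; ring_nf
  simp only [e] at this
  rw [sq]
  linarith

lemma J_total (h : GM μ Γ) (hn : 0 < n) {β : ℝ} (hβ : 0 < β) (θ : ℝ) {a b : ℝ}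
    (hab : a ^ 2 + b ^ 2 = 1) :
    ∑ j : Fin n, ∑ i : Fin n, J μ a b (uu β θ i) (uu β θ j) ≤ ∫ x, exp (θ * F β x) ∂μ := by
  have h1 := h.J_fin hn a b Finset.univ Finset.univ (fun i => uu_eg hn hβ θ i)
    (fun i => uu_eg hn hβ θ i)
  have h2 : (fun x => ∑ i : Fin n, uu β θ i x) = fun x => exp (θ / 2 * F β x) := by
    funext x
    simp only [uu, ← Finset.mul_sum, p_sum hn hβ, mul_one]
  rw [h2] at h1
  rw [Finset.sum_comm, ← h1]
  refine (h.J_self_le hn hab (expF_eg hn hβ (θ / 2))).trans (le_of_eq ?_)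
  congr 1; funext x
  rw [← Real.exp_add]; ring_nf

lemma var_triv (h : GM μ Γ) (hn : 0 < n) (hΓ : ∀ i j, Γ i j ≤ 1) {β : ℝ} (hβ : 0 < β) (θ : ℝ) :
    ∫ x, exp (θ * F β x) ∂μ - (∫ x, exp (θ / 2 * F β x) ∂μ) ^ 2 ≤
      θ ^ 2 / 4 * ∫ x, exp (θ * F β x) ∂μ := by
  have := cov_exp h hn hβ θ (fun r => r * ∫ x, exp (θ * F β x) ∂μ)
    (fun _ => 1 * ∫ x, exp (θ * F β x) ∂μ) (fun r => (hasDerivAt_id r).mul_const _)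
    (fun a b ha hb hab => by
      rw [one_mul]
      refine le_trans (Finset.sum_le_sum fun j _ => Finset.sum_le_sum fun i _ => ?_)
        (J_total h hn hβ θ hab)
      exact mul_le_of_le_one_left (h.J_pos (uu_nonneg _ _ _) (uu_nonneg _ _ _)) (hΓ j i))
  simpa using this

lemma var_main (h : GM μ Γ) (hn : 4 ≤ n) (hΓ : ∀ i j, Γ i j ≤ 1) (hd : ∀ i, Γ i i = 1)
    (ho : ∀ i j, i ≠ j → Γ i j ≤ 1 / 2) {β : ℝ} (hβ : 0 < β)
    (hβK : 22 * log n ≤ β * (sqrt (log n) / 16)) {m : ℕ} (hm : 0 < m)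
    (hmn : (m : ℝ) ≤ (n : ℝ) ^ (1 / 65536 : ℝ)) {v : ℝ} (hv : 0 ≤ v)
    (hfar : ∀ i j : Fin n, ((i : ℕ) + m ≤ j ∨ (j : ℕ) + m ≤ i) → Γ i j ≤ v)
    (hbig : log 4 ≤ log n / 131072) {θ : ℝ} (hθ : θ ^ 2 ≤ log n) :
    ∫ x, exp (θ * F β x) ∂μ - (∫ x, exp (θ / 2 * F β x) ∂μ) ^ 2 ≤
      θ ^ 2 / 4 * ((v + 54 / (log n / 131072)) * ∫ x, exp (θ * F β x) ∂μ) := by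
  have hn0 : 0 < n := by omega
  have hn4 : (4 : ℝ) ≤ n := by exact_mod_cast hn
  have hnp : (0 : ℝ) < n := by linarith
  set A := ∫ x, exp (θ * F β x) ∂μ with hA
  have hA0 : 0 ≤ A := integral_nonneg fun x => (exp_pos _).le
  set l := log n / 131072 with hl
  have hlp : 0 < l := lt_of_lt_of_le (log_pos (by norm_num)) hbig
  set C : ℕ → Finset (Fin n) := fun k => Finset.univ.filter fun i : Fin n => (i : ℕ) / m = k with hC
  have hmaps : ∀ i ∈ (Finset.univ : Finset (Fin n)), (i : ℕ) / m ∈ Finset.range n := fun i _ => by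
    rw [Finset.mem_range]
    exact lt_of_le_of_lt (Nat.div_le_self _ _) i.2
  have hfib : ∀ f : Fin n → ℝ, ∑ k ∈ Finset.range n, ∑ i ∈ C k, f i = ∑ i, f i := fun f =>
    Finset.sum_fiberwise_of_maps_to hmaps f
  have hcard : ∀ k, ((C k).card : ℝ) ≤ (n : ℝ) ^ (1 / 65536 : ℝ) := by
    intro k
    refine le_trans ?_ hmn
    have : (C k).card ≤ (Finset.Ico (k * m) (k * m + m)).card := by
      refine Finset.card_le_card_of_injOn (fun i => (i : ℕ)) ?_ ?_
      · intro i hi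
        simp only [hC, Finset.coe_filter, Finset.mem_univ, true_and, Set.mem_ofPred_eq] at hi
        have h1 := Nat.div_add_mod (i : ℕ) m
        have h2 := Nat.mod_lt (i : ℕ) hm
        rw [hi] at h1
        simp only [Finset.coe_Ico, Set.mem_Ico]
        rw [mul_comm k m]
        omega
      · exact fun i _ j _ hij => Fin.ext hij
    simp at this
    exact_mod_cast this
  have hsum : ∀ x, ∑ k ∈ Finset.range n, q β (C k) x = 1 := fun x => by
    rw [← p_sum hn0 hβ x, ← hfib]; rfl
  have hbase : ∀ a b, 0 ≤ a → a ≤ 1 / 4096 → 0 ≤ b → a ^ 2 + b ^ 2 = 1 →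
      SS (Finset.range n) C θ μ β a b ≤ A * exp (-l) := by
    intro a b ha ha' hb hab
    refine (base_S h hn hΓ hd ho hβ hβK ha ha' hb hab (Finset.range n) C hcard hsum hθ).trans ?_
    rw [mul_comm]
    gcongr
    rw [rpow_def_of_pos hnp, ← exp_log (by norm_num : (0 : ℝ) < 4), ← Real.exp_add]
    apply exp_le_exp.2
    have : log n = 131072 * l := by rw [hl]; ring
    rw [this]
    linarith
  have hlin := SS_lin (Finset.range n) C θ h hn0 hβ hsum hlp.le hbase
  have hB : ∀ r, HasDerivAt (fun r => (v * r + 3 * (18 / l) * exp (-(l / 18 * (1 - r)))) * A)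
      ((v + 3 * exp (-(l / 18 * (1 - r)))) * A) r := by
    intro r
    have h1 : HasDerivAt (fun r : ℝ => -(l / 18 * (1 - r))) (l / 18) r := by
      have := (((hasDerivAt_id r).const_sub 1).const_mul (l / 18)).neg
      refine HasDerivAt.congr_deriv this ?_
      ring
    have h2 := (((hasDerivAt_id r).const_mul v).add (h1.exp.const_mul (3 * (18 / l)))).mul_const A
    refine HasDerivAt.congr_deriv h2 ?_
    field_simp
  have key := cov_exp h hn0 hβ θ _ _ hB (fun a b ha hb hab => ?_)
  · refine key.trans ?_
    gcongr
    have e0 : 0 ≤ 3 * (18 / l) * exp (-(l / 18 * (1 - 0))) := by positivity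
    have : (v * 1 + 3 * (18 / l) * exp (-(l / 18 * (1 - 1)))) * A -
        (v * 0 + 3 * (18 / l) * exp (-(l / 18 * (1 - 0)))) * A ≤ (v + 54 / l) * A := by
      rw [← sub_mul]
      gcongr
      simp only [sub_self, mul_zero, neg_zero, exp_zero]
      have : 3 * (18 / l) * 1 = 54 / l := by ring
      linarith
    exact this
  · set e : ℕ → ℕ → ℝ := fun k l => if k ≤ l + 1 ∧ l ≤ k + 1 then (1 : ℝ) else 0 with he
    set T : ℕ → ℕ → ℝ := fun k l => J μ a b (G β θ (C l)) (G β θ (C k)) with hT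
    have hΓe : ∀ i j : Fin n, Γ j i ≤ v + e ((j : ℕ) / m) ((i : ℕ) / m) := by
      intro i j
      simp only [he]
      split_ifs with hij
      · linarith [hΓ j i]
      · rw [add_zero]
        apply hfar
        have h1 := Nat.div_add_mod (i : ℕ) m
        have h2 := Nat.mod_lt (i : ℕ) hm
        have h3 := Nat.div_add_mod (j : ℕ) m
        have h4 := Nat.mod_lt (j : ℕ) hm
        rw [not_and_or, not_le, not_le] at hij
        rcases hij with hij | hij
        · right
          have := Nat.mul_le_mul_left m (Nat.succ_le_of_lt hij)
          simp only [Nat.succ_eq_add_one, mul_add] at this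
          omega
        · left
          have := Nat.mul_le_mul_left m (Nat.succ_le_of_lt hij)
          simp only [Nat.succ_eq_add_one, mul_add] at this
          omega
    have hJp : ∀ i j : Fin n, 0 ≤ J μ a b (uu β θ i) (uu β θ j) := fun i j =>
      h.J_pos (uu_nonneg _ _ _) (uu_nonneg _ _ _)
    have s1 : ∑ j : Fin n, ∑ i : Fin n, Γ j i * J μ a b (uu β θ i) (uu β θ j) ≤
        v * (∑ j : Fin n, ∑ i : Fin n, J μ a b (uu β θ i) (uu β θ j)) +
        ∑ j : Fin n, ∑ i : Fin n, e ((j : ℕ) / m) ((i : ℕ) / m) *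
          J μ a b (uu β θ i) (uu β θ j) := by
      rw [Finset.mul_sum, ← Finset.sum_add_distrib]
      refine Finset.sum_le_sum fun j _ => ?_
      rw [Finset.mul_sum, ← Finset.sum_add_distrib]
      refine Finset.sum_le_sum fun i _ => ?_
      rw [← add_mul]
      exact mul_le_mul_of_nonneg_right (hΓe i j) (hJp i j)
    have s2 : ∑ j : Fin n, ∑ i : Fin n, e ((j : ℕ) / m) ((i : ℕ) / m) *
          J μ a b (uu β θ i) (uu β θ j) =
        ∑ k ∈ Finset.range n, ∑ l ∈ Finset.range n, e k l * T k l := by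
      rw [← hfib]
      refine Finset.sum_congr rfl fun k _ => ?_
      have : ∀ j ∈ C k, ∑ i : Fin n, e ((j : ℕ) / m) ((i : ℕ) / m) *
          J μ a b (uu β θ i) (uu β θ j) = ∑ l ∈ Finset.range n, ∑ i ∈ C l,
            e k l * J μ a b (uu β θ i) (uu β θ j) := by
        intro j hj
        rw [← hfib]
        refine Finset.sum_congr rfl fun l _ => Finset.sum_congr rfl fun i hi => ?_
        rw [(Finset.mem_filter.1 hj).2, (Finset.mem_filter.1 hi).2]
      rw [Finset.sum_congr rfl this, Finset.sum_comm]
      refine Finset.sum_congr rfl fun l _ => ?_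
      simp only [hT, G_uu]
      rw [h.J_fin hn0 a b _ _ (fun i => uu_eg hn0 hβ θ i) (fun i => uu_eg hn0 hβ θ i),
        Finset.sum_comm, Finset.mul_sum]
      refine Finset.sum_congr rfl fun j _ => ?_
      rw [Finset.mul_sum]
    have s3 := near_sum n T (fun k => h.J_nonneg hn0 ha hab (G_eg hn0 hβ θ (C k)))
      (fun k l => by
        have := h.J_le hn0 ha hab (G_eg hn0 hβ θ (C l)) (G_eg hn0 hβ θ (C k))
        simp only [hT]; linarith)
    have s4 := hlin a b ha hb hab
    have s5 := mul_le_mul_of_nonneg_left (J_total h hn0 hβ θ hab) hv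
    have s6 : ∑ k ∈ Finset.range n, T k k = SS (Finset.range n) C θ μ β a b := rfl
    rw [s6] at s3
    rw [s2] at s1
    have : ∑ k ∈ Finset.range n, ∑ l ∈ Finset.range n, e k l * T k l ≤
      3 * SS (Finset.range n) C θ μ β a b := s3
    nlinarith

lemma var_bound (h : GM μ Γ) (hn : 2 ≤ n) (hΓ : ∀ i j, Γ i j ≤ 1) (hd : ∀ i, Γ i i = 1)
    (ho : ∀ i j, i ≠ j → Γ i j ≤ 1 / 2) {β : ℝ} (hβK : 352 * sqrt (log n) ≤ β) {m : ℕ}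
    (hm : 0 < m) (hmn : (m : ℝ) ≤ (n : ℝ) ^ (1 / 65536 : ℝ)) {v : ℝ} (hv : 1 / log n ≤ v)
    (hfar : ∀ i j : Fin n, ((i : ℕ) + m ≤ j ∨ (j : ℕ) + m ≤ i) → Γ i j ≤ v)
    {θ : ℝ} (hθ : θ ^ 2 ≤ log n) :
    ∫ x, exp (θ * F β x) ∂μ - (∫ x, exp (θ / 2 * F β x) ∂μ) ^ 2 ≤
      (2000000 * v) * θ ^ 2 * ∫ x, exp (θ * F β x) ∂μ := by
  have hn0 : 0 < n := by omega
  have hn2 : (2 : ℝ) ≤ n := by exact_mod_cast hn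
  have hnp : (0 : ℝ) < n := by linarith
  have hlog : 0 < log n := log_pos (by linarith)
  have hL : 0 < sqrt (log n) := sqrt_pos.2 hlog
  have hL2 : sqrt (log n) ^ 2 = log n := sq_sqrt hlog.le
  have hβ : 0 < β := by linarith
  have hv0 : 0 < v := lt_of_lt_of_le (by positivity) hv
  have hv1 : 1 ≤ v * log n := by rwa [div_le_iff₀ hlog] at hv
  set A := ∫ x, exp (θ * F β x) ∂μ with hA
  have hA0 : 0 ≤ A := integral_nonneg fun x => (exp_pos _).le
  have hl4 : log 4 ≤ 2 := by
    have : log 4 = 2 * log 2 := by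
      rw [show (4 : ℝ) = 2 ^ 2 by norm_num, log_pow]; norm_num
    have := Real.log_two_lt_d9
    linarith
  rcases le_or_gt (log 4) (log n / 131072) with hbig | hsmall
  · have hn4 : 4 ≤ n := by
      have : log 4 ≤ log n := by
        have : (0 : ℝ) < log 4 := log_pos (by norm_num)
        linarith
      rw [log_le_log_iff (by norm_num) hnp] at this
      exact_mod_cast this
    refine (var_main h hn4 hΓ hd ho hβ (by nlinarith) hm hmn hv0.le hfar hbig hθ).trans ?_
    have e : 54 / (log n / 131072) = 7077888 * (1 / log n) := by field_simp; norm_num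
    have e1 : v + 54 / (log n / 131072) ≤ 8000000 * v := by rw [e]; linarith
    calc θ ^ 2 / 4 * ((v + 54 / (log n / 131072)) * A) ≤ θ ^ 2 / 4 * ((8000000 * v) * A) := by gcongr
      _ = _ := by ring
  · refine (var_triv h hn0 hΓ hβ θ).trans ?_
    have : 1 / 4 ≤ 2000000 * v := by nlinarith
    calc θ ^ 2 / 4 * A = 1 / 4 * θ ^ 2 * A := by ring
      _ ≤ _ := by gcongr

end SGS

open MeasureTheory ProbabilityTheory Real

namespace SGS
open Filter Topology

variable {n : ℕ} {μ : Measure (Fin n → ℝ)} {Γ : Fin n → Fin n → ℝ}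

lemma iter_k (h : GM μ Γ) (hn : 0 < n) (hΓ : ∀ i j, Γ i j ≤ 1) {β : ℝ} (hβ : 0 < β) {T Kc : ℝ}
    (hK : 0 ≤ Kc) (hKT : Kc * T ≤ 1 / 2)
    (hvar : ∀ θ : ℝ, θ ^ 2 ≤ T → ∫ x, exp (θ * F β x) ∂μ - (∫ x, exp (θ / 2 * F β x) ∂μ) ^ 2 ≤
      Kc * θ ^ 2 * ∫ x, exp (θ * F β x) ∂μ) (k : ℕ) :
    ∀ θ : ℝ, θ ^ 2 ≤ T → ∫ x, exp (θ * F β x) ∂μ ≤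
      exp (θ * (∫ x, F β x ∂μ) + 4 * Kc * θ ^ 2 * (1 - (1 / 2) ^ k) + θ ^ 2 / 2 * (1 / 2) ^ k) := by
  induction k with
  | zero =>
    intro θ _
    have := herbst' h hn hΓ hβ θ
    simpa using this
  | succ k ih =>
    intro θ hθ
    set A := ∫ x, exp (θ * F β x) ∂μ with hA
    set M := ∫ x, F β x ∂μ with hM
    have hA0 : 0 ≤ A := integral_nonneg fun x => (exp_pos _).le
    have h1 := ih (θ / 2) (by nlinarith [sq_nonneg θ])
    have h2 := hvar θ hθ
    set D := ∫ x, exp (θ / 2 * F β x) ∂μ with hD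
    have hD0 : 0 ≤ D := integral_nonneg fun x => (exp_pos _).le
    set y := Kc * θ ^ 2 with hy
    have hy0 : 0 ≤ y := by positivity
    have hy1 : y ≤ 1 / 2 := le_trans (by rw [hy]; gcongr) hKT
    have e1 : 1 ≤ (1 - y) * exp (2 * y) := by
      have := Real.add_one_le_exp (2 * y)
      nlinarith
    have h3 : A ≤ exp (2 * y) * D ^ 2 := by
      have : A * (1 - y) ≤ D ^ 2 := by linarith
      calc A = A * 1 := by ring
        _ ≤ A * ((1 - y) * exp (2 * y)) := by gcongr
        _ = exp (2 * y) * (A * (1 - y)) := by ring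
        _ ≤ _ := by gcongr
    refine h3.trans ?_
    refine (mul_le_mul_of_nonneg_left (pow_le_pow_left₀ hD0 h1 2) (exp_pos _).le).trans ?_
    rw [← Real.exp_nat_mul, ← Real.exp_add]
    apply exp_le_exp.2
    apply le_of_eq
    rw [hy, pow_succ]
    push_cast
    ring

lemma iter_lim (h : GM μ Γ) (hn : 0 < n) (hΓ : ∀ i j, Γ i j ≤ 1) {β : ℝ} (hβ : 0 < β) {T Kc : ℝ}
    (hK : 0 ≤ Kc) (hKT : Kc * T ≤ 1 / 2)
    (hvar : ∀ θ : ℝ, θ ^ 2 ≤ T → ∫ x, exp (θ * F β x) ∂μ - (∫ x, exp (θ / 2 * F β x) ∂μ) ^ 2 ≤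
      Kc * θ ^ 2 * ∫ x, exp (θ * F β x) ∂μ) {θ : ℝ} (hθ : θ ^ 2 ≤ T) :
    ∫ x, exp (θ * F β x) ∂μ ≤ exp (θ * (∫ x, F β x ∂μ) + 2) := by
  have hpow : Tendsto (fun k : ℕ => ((1 : ℝ) / 2) ^ k) atTop (𝓝 0) :=
    tendsto_pow_atTop_nhds_zero_of_lt_one (by norm_num) (by norm_num)
  have hlim : Tendsto (fun k : ℕ => exp (θ * (∫ x, F β x ∂μ) + 4 * Kc * θ ^ 2 * (1 - (1 / 2) ^ k) +
      θ ^ 2 / 2 * (1 / 2) ^ k)) atTop (𝓝 (exp (θ * (∫ x, F β x ∂μ) + 4 * Kc * θ ^ 2 * (1 - 0) +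
      θ ^ 2 / 2 * 0))) :=
    ((continuous_exp.tendsto _).comp (((hpow.const_sub 1).const_mul _).const_add _ |>.add
      (hpow.const_mul _)))
  refine (ge_of_tendsto' hlim fun k => iter_k h hn hΓ hβ hK hKT hvar k θ hθ).trans ?_
  apply exp_le_exp.2
  have : Kc * θ ^ 2 ≤ 1 / 2 := le_trans (by gcongr) hKT
  linarith

lemma pow_four_trick {P y : ℝ} (h0 : 0 ≤ P) (h1 : P ≤ 1) (h2 : P ≤ 6 ^ 4 * exp (-y)) :
    P ≤ 6 * exp (-(y / 4)) := by
  have e : (6 * exp (-(y / 4))) ^ 4 = 6 ^ 4 * exp (-y) := by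
    rw [mul_pow, ← Real.exp_nat_mul]; congr 2; push_cast; ring
  have h3 : P ^ 4 ≤ P := by
    calc P ^ 4 ≤ P ^ 1 := pow_le_pow_of_le_one h0 h1 (by norm_num)
      _ = P := pow_one P
  exact le_of_pow_le_pow_left₀ (by norm_num : 4 ≠ 0) (by positivity) (by rw [e]; linarith)

lemma conc (h : GM μ Γ) (hn : 2 ≤ n) (hΓ : ∀ i j, Γ i j ≤ 1) (hd : ∀ i, Γ i i = 1)
    (ho : ∀ i j, i ≠ j → Γ i j ≤ 1 / 2) {m : ℕ}
    (hm : 0 < m) (hmn : (m : ℝ) ≤ (n : ℝ) ^ (1 / 65536 : ℝ)) {v : ℝ} (hv : 1 / log n ≤ v)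
    (hfar : ∀ i j : Fin n, ((i : ℕ) + m ≤ j ∨ (j : ℕ) + m ≤ i) → Γ i j ≤ v) (t : ℝ) :
    μ.real {x | t < |(⨆ i, x i) - ∫ x', (⨆ i, x' i) ∂μ|} ≤
      6 * exp (-(1 / 8000) * t / sqrt v) := by
  have := h.prob
  have hn0 : 0 < n := by omega
  have : Nonempty (Fin n) := ⟨⟨0, hn0⟩⟩
  have hn2 : (2 : ℝ) ≤ n := by exact_mod_cast hn
  have hnp : (0 : ℝ) < n := by linarith
  have hlog : 0 < log n := log_pos (by linarith)
  set L := sqrt (log n) with hLdef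
  have hL : 0 < L := sqrt_pos.2 hlog
  have hL2 : L ^ 2 = log n := sq_sqrt hlog.le
  have hv0 : 0 < v := lt_of_lt_of_le (by positivity) hv
  set σ := sqrt v with hσ
  have hσp : 0 < σ := sqrt_pos.2 hv0
  have hσ2 : σ ^ 2 = v := sq_sqrt hv0.le
  have hv1 : 1 ≤ v * log n := by rwa [div_le_iff₀ hlog] at hv
  have hσL : 1 ≤ σ * L := by
    have : 1 ^ 2 ≤ (σ * L) ^ 2 := by rw [mul_pow, hσ2, hL2]; linarith
    exact le_of_pow_le_pow_left₀ two_ne_zero (by positivity) this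
  set β := 352 * L + L ^ 3 with hβdef
  have hβ : 0 < β := by positivity
  have hη : log n / β ≤ σ := by
    rw [div_le_iff₀ hβ, ← hL2]
    have : L ^ 2 * 1 ≤ L ^ 2 * (σ * L) := by gcongr
    have : 0 ≤ σ * (352 * L) := by positivity
    rw [hβdef]; nlinarith
  set θ := 1 / 2000 / σ with hθ
  have hθp : 0 < θ := by positivity
  have hθ2 : θ ^ 2 = 1 / 4000000 / v := by rw [hθ, div_pow, hσ2]; norm_num
  have hvar : ∀ θ' : ℝ, θ' ^ 2 ≤ θ ^ 2 → ∫ x, exp (θ' * F β x) ∂μ -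
      (∫ x, exp (θ' / 2 * F β x) ∂μ) ^ 2 ≤
      (2000000 * v) * θ' ^ 2 * ∫ x, exp (θ' * F β x) ∂μ := by
    intro θ' hθ'
    refine var_bound h hn hΓ hd ho (by rw [hβdef]; have : 0 ≤ L ^ 3 := by positivity
                                       linarith) hm hmn hv hfar (hθ'.trans ?_)
    rw [hθ2, div_le_iff₀ hv0]
    linarith
  have hKT : 2000000 * v * θ ^ 2 ≤ 1 / 2 := by
    rw [hθ2]; apply le_of_eq; field_simp; norm_num
  have hA : ∀ θ' : ℝ, θ' ^ 2 = θ ^ 2 →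
      ∫ x, exp (θ' * F β x) ∂μ ≤ exp (θ' * (∫ x, F β x ∂μ) + 2) := fun θ' h' =>
    iter_lim h hn0 hΓ hβ (by positivity) hKT hvar h'.le
  set M := ∫ x, F β x ∂μ with hM
  have tail : ∀ s, μ.real {x | s ≤ |F β x - M|} ≤ 2 * exp (2 - θ * s) := by
    intro s
    have hsub : {x : Fin n → ℝ | s ≤ |F β x - M|} ⊆ {x | M + s ≤ F β x} ∪ {x | F β x ≤ M - s} := by
      intro x hx
      rcases le_abs.1 (show s ≤ |F β x - M| from hx) with hx | hx
      · left; show M + s ≤ F β x; linarith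
      · right; show F β x ≤ M - s; linarith
    refine (measureReal_mono hsub (measure_ne_top _ _)).trans ?_
    refine (measureReal_union_le _ _).trans ?_
    have t1 : μ.real {x | M + s ≤ F β x} ≤ exp (2 - θ * s) := by
      refine (measure_ge_le_exp_mul_mgf (μ := μ) (X := F β) (t := θ) (M + s) hθp.le
        (h.int hn0 (expF_eg hn0 hβ θ))).trans ?_
      simp only [ProbabilityTheory.mgf]
      refine (mul_le_mul_of_nonneg_left (hA θ rfl) (exp_pos _).le).trans ?_
      rw [← Real.exp_add]
      apply exp_le_exp.2
      linarith
    have t2 : μ.real {x | F β x ≤ M - s} ≤ exp (2 - θ * s) := by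
      refine (measure_le_le_exp_mul_mgf (μ := μ) (X := F β) (t := -θ) (M - s) (by linarith)
        (h.int hn0 (expF_eg hn0 hβ (-θ)))).trans ?_
      simp only [ProbabilityTheory.mgf]
      refine (mul_le_mul_of_nonneg_left (hA (-θ) (by ring)) (exp_pos _).le).trans ?_
      rw [← Real.exp_add]
      apply exp_le_exp.2
      linarith
    linarith
  have hbd : ∀ x : Fin n → ℝ, BddAbove (Set.range x) := fun x => Set.Finite.bddAbove (Set.finite_range x)
  have hmx1 : ∀ x : Fin n → ℝ, (⨆ i, x i) ≤ F β x := fun x => ciSup_le fun i => le_F hn0 hβ i x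
  have hmx2 : ∀ x : Fin n → ℝ, F β x ≤ (⨆ i, x i) + σ := fun x => by
    have := F_le hn0 hβ x (⨆ i, x i) fun i => le_ciSup (hbd x) i
    linarith
  have hFi := h.int hn0 (F_eg hn0 hβ (n := n))
  have hmi : Integrable (fun x : Fin n → ℝ => ⨆ i, x i) μ := by
    refine Integrable.mono' (hFi.abs.add (integrable_const σ))
      (Measurable.iSup fun i => measurable_pi_apply i).aestronglyMeasurable (ae_of_all _ fun x => ?_)
    simp only [Pi.add_apply]
    rw [Real.norm_eq_abs, abs_le]
    have h1 := hmx1 x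
    have h2 := hmx2 x
    have h3 := neg_abs_le (F β x)
    have h4 := le_abs_self (F β x)
    constructor <;> linarith
  set E := ∫ x', (⨆ i, x' i) ∂μ with hE
  have hE1 : E ≤ M := integral_mono hmi hFi hmx1
  have hE2 : M ≤ E + σ := by
    have := integral_mono hFi (hmi.add (integrable_const σ)) hmx2
    refine this.trans (le_of_eq ?_)
    simp only [Pi.add_apply]
    rw [integral_add hmi (integrable_const σ)]
    simp [hE]
  have hsub : {x : Fin n → ℝ | t < |(⨆ i, x i) - E|} ⊆ {x | t - 2 * σ ≤ |F β x - M|} := by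
    intro x hx
    have hx' : t < |(⨆ i, x i) - E| := hx
    show t - 2 * σ ≤ |F β x - M|
    have h1 := hmx1 x
    have h2 := hmx2 x
    have h3 := le_abs_self (F β x - M)
    have h4 := neg_abs_le (F β x - M)
    rcases lt_abs.1 hx' with h5 | h5 <;> linarith
  have hfin : μ.real {x : Fin n → ℝ | t < |(⨆ i, x i) - E|} ≤ 6 ^ 4 * exp (-(θ * t)) := by
    refine (measureReal_mono hsub (measure_ne_top _ _)).trans ((tail _).trans ?_)
    have e1 : θ * σ = 1 / 2000 := by rw [hθ]; field_simp
    have e2 : 2 - θ * (t - 2 * σ) ≤ 3 + -(θ * t) := by nlinarith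
    calc 2 * exp (2 - θ * (t - 2 * σ)) ≤ 2 * exp (3 + -(θ * t)) := by gcongr
      _ = (2 * exp 3) * exp (-(θ * t)) := by rw [Real.exp_add]; ring
      _ ≤ _ := by
        gcongr
        have := Real.exp_one_lt_d9
        have e : exp 3 = exp 1 ^ 3 := by rw [← Real.exp_nat_mul]; norm_num
        have : exp 1 ^ 3 ≤ 3 ^ 3 := by gcongr; linarith
        rw [e]; linarith
  refine (pow_four_trick measureReal_nonneg measureReal_le_one hfin).trans (le_of_eq ?_)
  congr 2
  rw [hθ]; ring

end SGS

open MeasureTheory ProbabilityTheory Real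
namespace SGS
open Filter Topology

lemma exists_angle (a b : ℝ) (h : a ^ 2 + b ^ 2 = 1) : ∃ θ : ℝ, Real.cos θ = a ∧ Real.sin θ = b := by
  have hn : ‖(⟨a, b⟩ : ℂ)‖ = 1 := by
    have h2 : ‖(⟨a, b⟩ : ℂ)‖ ^ 2 = 1 := by
      rw [← Complex.normSq_eq_norm_sq, Complex.normSq_mk]; linarith
    nlinarith [norm_nonneg (⟨a, b⟩ : ℂ)]
  have hc := Complex.norm_mul_cos_arg (⟨a, b⟩ : ℂ)
  have hs := Complex.norm_mul_sin_arg (⟨a, b⟩ : ℂ)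
  rw [hn, one_mul] at hc hs
  exact ⟨_, hc, hs⟩

lemma GM_of {Ω : Type*} [MeasurableSpace Ω] (P : Measure Ω) [IsProbabilityMeasure P]
    (X : ℕ → Ω → ℝ) (hXmeas : ∀ i, Measurable (X i))
    (hgauss : ∀ (k : ℕ) (s : Fin k → ℕ) (a : Fin k → ℝ), ∃ v : NNReal,
      P.map (fun ω => ∑ i, a i * X (s i) ω) = gaussianReal 0 v)
    (φ : ℕ → ℝ) (hφ0 : φ 0 = 1)
    (hcov : ∀ i j, ∫ ω, X i ω * X j ω ∂P = φ (max i j - min i j)) (n : ℕ) :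
    GM (P.map (fun ω => fun i : Fin n => X (i + 1) ω))
      (fun i j => φ (max ((i : ℕ) + 1) (j + 1) - min ((i : ℕ) + 1) (j + 1))) := by
  have hm : Measurable (fun ω => fun i : Fin n => X (i + 1) ω) :=
    measurable_pi_lambda _ fun i => hXmeas _
  set μ := P.map (fun ω => fun i : Fin n => X (i + 1) ω) with hμ
  haveI hp : IsProbabilityMeasure μ := Measure.isProbabilityMeasure_map hm.aemeasurable
  have hL : ∀ L : (Fin n → ℝ) →L[ℝ] ℝ, ∃ v : NNReal, μ.map L = gaussianReal 0 v := by
    intro L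
    obtain ⟨v, hv⟩ := hgauss n (fun i => (i : ℕ) + 1) (fun i => L (Pi.single i 1))
    refine ⟨v, ?_⟩
    rw [hμ, Measure.map_map L.continuous.measurable hm, ← hv]
    congr 1
    ext ω
    simp only [Function.comp]
    conv_lhs => rw [pi_eq_sum_univ' (fun i : Fin n => X (i + 1) ω)]
    rw [map_sum]
    refine Finset.sum_congr rfl fun i _ => ?_
    rw [map_smul, smul_eq_mul, mul_comm]
  haveI hG : IsGaussian μ := isGaussian_of_map_eq_gaussianReal fun L => ⟨0, hL L⟩
  have h0 : ∀ L : StrongDual ℝ (Fin n → ℝ), μ[L] = 0 := by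
    intro L
    obtain ⟨v, hv⟩ := hL L
    have : ∫ x, x ∂(μ.map L) = ∫ x, L x ∂μ :=
      integral_map L.continuous.measurable.aemeasurable (by fun_prop)
    rw [← this, hv, integral_id_gaussianReal]
  refine ⟨hp, ?_, ?_, ?_⟩
  · intro a b hab
    obtain ⟨θ, hc, hs⟩ := exists_angle b (-a) (by linarith [neg_sq a])
    have h1 := IsGaussian.map_rotation_eq_self_of_forall_strongDual_eq_zero (μ := μ) h0 θ
    have h2 : (fun z : (Fin n → ℝ) × (Fin n → ℝ) => (a • z.1 + b • z.2, b • z.1 - a • z.2))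
        = Prod.swap ∘ (ContinuousLinearMap.rotation θ) := by
      ext z i
      · simp [ContinuousLinearMap.rotation_apply, hc, hs]
      · simp [ContinuousLinearMap.rotation_apply, hc, hs, sub_eq_add_neg]
    rw [h2, ← Measure.map_map measurable_swap (ContinuousLinearMap.continuous _).measurable, h1,
      Measure.prod_swap]
  · intro i
    obtain ⟨v, hv⟩ := hgauss 1 (fun _ => (i : ℕ) + 1) (fun _ => 1)
    simp only [Fin.sum_univ_one, one_mul] at hv
    have h1 : ∫ x, x ^ 2 ∂(P.map (X (i + 1))) = 1 := by
      rw [integral_map (hXmeas _).aemeasurable (by fun_prop)]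
      have := hcov (i + 1) (i + 1)
      simp only [max_self, min_self, tsub_self, hφ0] at this
      rw [← this]; simp only [sq]
    change P.map (X (i + 1)) = _ at hv
    have h2 : (v : ℝ) = 1 := by
      rw [hv] at h1
      rw [← h1, ← variance_id_gaussianReal (μ := 0) (v := v),
        variance_of_integral_eq_zero aemeasurable_id (by simpa using integral_id_gaussianReal)]
      rfl
    have h3 : v = 1 := by exact_mod_cast h2
    rw [hμ, Measure.map_map (measurable_pi_apply i) hm, ← h3, ← hv]
    rfl
  · intro i j
    rw [hμ, integral_map hm.aemeasurable (by fun_prop)]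
    exact hcov _ _

lemma iSup_conv {Ω : Type*} (X : ℕ → Ω → ℝ) (n : ℕ) (ω : Ω) :
    (⨆ i : Set.Icc 1 n, X i ω) = ⨆ i : Fin n, X (i + 1) ω := by
  symm
  refine Function.Surjective.iSup_congr (fun i : Fin n => (⟨i + 1, by constructor <;> omega⟩ : Set.Icc 1 n)) ?_ ?_
  · rintro ⟨k, hk1, hk2⟩
    exact ⟨⟨k - 1, by omega⟩, Subtype.ext (by change k - 1 + 1 = k; omega)⟩
  · intro i; rfl

end SGS

theorem stationary_gaussian_sequence_superconcentration
    {Ω : Type*} [MeasurableSpace Ω] (P : Measure Ω) [IsProbabilityMeasure P]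
    (X : ℕ → Ω → ℝ) (hXmeas : ∀ i, Measurable (X i))
    -- every finite subfamily is jointly centered Gaussian
    (hgauss : ∀ (k : ℕ) (s : Fin k → ℕ) (a : Fin k → ℝ), ∃ v : NNReal,
      P.map (fun ω => ∑ i, a i * X (s i) ω) = gaussianReal 0 v)
    (φ : ℕ → ℝ) (hφ0 : φ 0 = 1)
    -- stationary covariance structure: `Cov(X_i, X_j) = φ(|i − j|)`
    (hcov : ∀ i j, ∫ ω, X i ω * X j ω ∂P = φ (max i j - min i j))
    (hφmono : Antitone φ) (hφ1 : φ 1 < 1 / 2) :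
    ∃ α ∈ Set.Ioo (0 : ℝ) 1, ∃ c : ℝ, 0 < c ∧
      ∀ n : ℕ, 2 ≤ n → ∀ t : ℝ, 0 ≤ t →
        (P {ω | t < |(⨆ i : Set.Icc 1 n, X i ω) -
            ∫ ω', (⨆ i : Set.Icc 1 n, X i ω') ∂P|}).toReal ≤
          6 * Real.exp (-c * t /
            Real.sqrt (max (φ ⌊(n : ℝ) ^ α⌋₊) (1 / Real.log n))) := by
  refine ⟨1 / 65536, ⟨by norm_num, by norm_num⟩, 1 / 8000, by norm_num, ?_⟩
  intro n hn t _
  have hm : Measurable (fun ω => fun i : Fin n => X (i + 1) ω) :=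
    measurable_pi_lambda _ fun i => hXmeas _
  have hG := SGS.GM_of P X hXmeas hgauss φ hφ0 hcov n
  have h1 : (1 : ℝ) ≤ (n : ℝ) ^ (1 / 65536 : ℝ) :=
    Real.one_le_rpow (by exact_mod_cast (by omega : 1 ≤ n)) (by norm_num)
  have key := SGS.conc hG hn
    (fun i j => hφ0 ▸ hφmono (Nat.zero_le _))
    (fun i => by simp [hφ0])
    (fun i j hij => by
      have : (i : ℕ) ≠ j := fun h => hij (Fin.ext h)
      exact (hφmono (by omega : 1 ≤ max ((i : ℕ) + 1) (j + 1) - min ((i : ℕ) + 1) (j + 1))).trans hφ1.le)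
    (m := ⌊(n : ℝ) ^ (1 / 65536 : ℝ)⌋₊) (Nat.floor_pos.2 h1)
    (Nat.floor_le (by positivity))
    (v := max (φ ⌊(n : ℝ) ^ (1 / 65536 : ℝ)⌋₊) (1 / Real.log n)) (le_max_right _ _)
    (fun i j hij => (hφmono (by omega)).trans (le_max_left _ _)) t
  have hs : Measurable (fun x : Fin n → ℝ => ⨆ i, x i) :=
    Measurable.iSup fun i => measurable_pi_apply i
  rw [integral_map hm.aemeasurable hs.aestronglyMeasurable,
    map_measureReal_apply hm (measurableSet_lt measurable_const
      ((hs.sub_const _).abs))] at key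
  simp only [SGS.iSup_conv]
  exact key
end
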